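/- The bilinear form ⟨⟨x,y⟩⟩ = M(x·𝒟̄(y)) on Â is symmetric and non-degenerate. Moreover, for x = ∏_{k∈[a,b]} x_k and y = ∏_{k∈[a,b]} y_k (ordered products with k decreasing from left to right) with homogeneous x_k, y_k ∈ Â[k], one has ⟨⟨x,y⟩⟩ = q^{Σ_{s<t} (wt x_s, wt x_t)} ∏_{k∈[a,b]} ⟨⟨x_k, y_k⟩⟩. -/

import Mathlib

/- Common setting: a symmetrizable generalized Cartan matrix, the field
`𝕂 = ℚ(q^{1/2})` (with `sqv = q^{1/2}` and `q = qh = sqv²`), quantum integers, the bosonic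
extension `hA A` presented by the `q`-Serre relations and the bosonic commutation
relations, its weight spaces and distinguished subalgebras, and the root-lattice
pairing. -/

set_option maxHeartbeats 1000000
set_option synthInstance.maxHeartbeats 400000

noncomputable section

structure GCM (I : Type) where
  c : I → I → ℤ
  d : I → ℤ
  d_pos : ∀ i, 0 < d i
  diag : ∀ i, c i i = 2
  offdiag : ∀ i j, i ≠ j → c i j ≤ 0
  dsymm : ∀ i j, d i * c i j = d j * c j i

abbrev 𝕂 : Type := RatFunc ℚ

/-- The square root `q^{1/2}` of `q`. -/
def sqv : 𝕂 := RatFunc.X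

/-- The indeterminate `q = (q^{1/2})²`. -/
def qh : 𝕂 := sqv ^ 2

def qNum (t : 𝕂) (n : ℕ) : 𝕂 := (t ^ n - t⁻¹ ^ n) / (t - t⁻¹)

def qFact (t : 𝕂) (n : ℕ) : 𝕂 := ∏ k ∈ Finset.range n, qNum t (k + 1)

def qBinom (t : 𝕂) (m k : ℕ) : 𝕂 := qFact t m / (qFact t k * qFact t (m - k))

variable {I : Type} [DecidableEq I]

/-- `q_i = q^{d_i}`. -/
def qd (A : GCM I) (i : I) : 𝕂 := qh ^ A.d i

/-- `ζ_i = 1 - q_i²`. -/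
def zi (A : GCM I) (i : I) : 𝕂 := 1 - qd A i ^ 2

/-- The `q`-Serre element `Σ_{k=0}^{b_{ij}} (-1)^k [b_{ij} choose k]_{q_i} a^k b a^{b_{ij}-k}`
for elements `a, b` of any `𝕂`-algebra, where `b_{ij} = 1 - c_{ij}`. -/
def serreIn {R : Type} [Ring R] [Algebra 𝕂 R] (A : GCM I) (i j : I) (a b : R) : R :=
  ∑ k ∈ Finset.range ((1 - A.c i j).toNat + 1),
    ((-1 : 𝕂) ^ k * qBinom (qd A i) ((1 - A.c i j).toNat) k) •
      (a ^ k * b * a ^ ((1 - A.c i j).toNat - k))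

/-- The defining relations of the bosonic extension: (a) for each `p`, the `q`-Serre
relations among the `f_{i,p}`; (b) for `m < p`,
`f_{i,m} f_{j,p} = q^{(-1)^{p-m+1}(α_i,α_j)} f_{j,p} f_{i,m} + δ_{(j,p),(i,m+1)}(1-q_i²)`. -/
inductive hARel (A : GCM I) : FreeAlgebra 𝕂 (I × ℤ) → FreeAlgebra 𝕂 (I × ℤ) → Prop
  | serre (i j : I) (p : ℤ) (h : i ≠ j) :
      hARel A (serreIn A i j (FreeAlgebra.ι 𝕂 (i, p)) (FreeAlgebra.ι 𝕂 (j, p))) 0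
  | comm (i j : I) (m p : ℤ) (h : m < p) :
      hARel A (FreeAlgebra.ι 𝕂 (i, m) * FreeAlgebra.ι 𝕂 (j, p))
        (qh ^ (((p - m + 1).negOnePow : ℤ) * (A.d i * A.c i j)) •
            (FreeAlgebra.ι 𝕂 (j, p) * FreeAlgebra.ι 𝕂 (i, m))
          + if j = i ∧ p = m + 1 then ((1 : 𝕂) - qd A i ^ 2) • 1 else 0)

/-- The bosonic extension `Â` associated with the generalized Cartan matrix. -/
abbrev hA (A : GCM I) : Type := RingQuot (hARel A)

/-- The generator `f_{i,p}` of the bosonic extension. -/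
def ff (A : GCM I) (i : I) (p : ℤ) : hA A :=
  RingQuot.mkAlgHom 𝕂 (hARel A) (FreeAlgebra.ι 𝕂 (i, p))

/-- The symmetric bilinear pairing on the root lattice, `(α_i, α_j) = d_i c_{ij}`. -/
def ip (A : GCM I) (β γ : I →₀ ℤ) : ℤ :=
  β.sum fun i a => γ.sum fun j b => a * b * (A.d i * A.c i j)

/-- `α_{i,m} = (-1)^m α_i` as an element of the root lattice. -/
def aim (i : I) (m : ℤ) : I →₀ ℤ := Finsupp.single i ((m.negOnePow : ℤ))

/-- The weight space of weight `β` of `Â`, where `wt (f_{i,p}) = (-1)^{p+1} α_i`. -/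
def hAwt (A : GCM I) (β : I →₀ ℤ) : Submodule 𝕂 (hA A) :=
  Submodule.span 𝕂 {x | ∃ l : List (I × ℤ),
    (l.map fun p => Finsupp.single p.1 (((p.2 + 1).negOnePow : ℤ))).sum = β ∧
    x = (l.map fun p => ff A p.1 p.2).prod}

/-- The subalgebra `Â[a,b]` generated by `{f_{i,k} | a ≤ k ≤ b}`. -/
def hAband (A : GCM I) (a b : ℤ) : Subalgebra 𝕂 (hA A) :=
  Algebra.adjoin 𝕂 {x | ∃ i k, a ≤ k ∧ k ≤ b ∧ x = ff A i k}

/-- The subalgebra `Â[m]`. -/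
def hAk (A : GCM I) (m : ℤ) : Subalgebra 𝕂 (hA A) := hAband A m m

/-- The subalgebra `Â_{≥ m}`. -/
def hAge (A : GCM I) (m : ℤ) : Subalgebra 𝕂 (hA A) :=
  Algebra.adjoin 𝕂 {x | ∃ i k, m ≤ k ∧ x = ff A i k}

/-- The subalgebra `Â_{≤ m}`. -/
def hAle (A : GCM I) (m : ℤ) : Subalgebra 𝕂 (hA A) :=
  Algebra.adjoin 𝕂 {x | ∃ i k, k ≤ m ∧ x = ff A i k}

/-- The subalgebra `Â_{> m}`. -/
def hAgt (A : GCM I) (m : ℤ) : Subalgebra 𝕂 (hA A) := hAge A (m + 1)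

/-- The subalgebra `Â_{< m}`. -/
def hAlt (A : GCM I) (m : ℤ) : Subalgebra 𝕂 (hA A) := hAle A (m - 1)

set_option linter.unusedSectionVars false

namespace BraidedFree

section Basic

variable {k : Type} [Field k]

/-- The monomial in the free algebra attached to a word. -/
def mon (k : Type) [Field k] {I : Type} (l : List I) : FreeAlgebra k I :=
  (l.map (FreeAlgebra.ι k)).prod

@[simp] lemma mon_nil : mon k ([] : List I) = 1 := rfl

@[simp] lemma mon_cons (i : I) (l : List I) :
    mon k (i :: l) = FreeAlgebra.ι k i * mon k l := by
  simp [mon]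

lemma basisFreeMonoid_ofList (l : List I) :
    FreeAlgebra.basisFreeMonoid k I (FreeMonoid.ofList l) = mon k l := by
  induction l with
  | nil => simp [FreeAlgebra.basisFreeMonoid, FreeAlgebra.equivMonoidAlgebraFreeMonoid]
  | cons i l ih =>
    rw [mon_cons, ← ih]
    simp [FreeAlgebra.basisFreeMonoid, FreeAlgebra.equivMonoidAlgebraFreeMonoid]

/-- The linear map out of the free algebra with prescribed values on words. -/
def ofWords {V : Type*} [AddCommGroup V] [Module k V] (g : List I → V) :
    FreeAlgebra k I →ₗ[k] V :=
  (FreeAlgebra.basisFreeMonoid k I).constr k fun w => g w.toList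

@[simp] lemma ofWords_mon {V : Type*} [AddCommGroup V] [Module k V] (g : List I → V)
    (l : List I) : ofWords (k := k) g (mon k l) = g l := by
  rw [← basisFreeMonoid_ofList, ofWords, Module.Basis.constr_basis]
  rfl

lemma word_induction {P : FreeAlgebra k I → Prop} (h1 : P 1)
    (hadd : ∀ x y, P x → P y → P (x + y)) (hsmul : ∀ (c : k) x, P x → P (c • x))
    (hmul : ∀ i x, P x → P (FreeAlgebra.ι k i * x)) (x : FreeAlgebra k I) : P x := by
  suffices h : ∀ y, P y → P (x * y) by simpa using h 1 h1
  induction x using FreeAlgebra.induction with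
  | grade0 r => intro y hy; rw [← Algebra.smul_def]; exact hsmul r y hy
  | grade1 i => intro y hy; exact hmul i y hy
  | mul a b ha hb => intro y hy; rw [mul_assoc]; exact ha _ (hb _ hy)
  | add a b ha hb => intro y hy; rw [add_mul]; exact hadd _ _ (ha _ hy) (hb _ hy)

lemma linearMap_ext {V : Type*} [AddCommGroup V] [Module k V]
    {f g : FreeAlgebra k I →ₗ[k] V} (h : ∀ l, f (mon k l) = g (mon k l)) : f = g := by
  refine (FreeAlgebra.basisFreeMonoid k I).ext fun w => ?_
  have := h w.toList
  rwa [← basisFreeMonoid_ofList] at this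

end Basic
end BraidedFree

namespace BraidedFree

section Derivations

variable {k : Type} [Field k] (χ : I → I → k)

open FreeAlgebra (ι)

/-- The automorphism of the free algebra scaling the generator `j` by `χ i j`. -/
def kap (i : I) : FreeAlgebra k I →ₐ[k] FreeAlgebra k I :=
  FreeAlgebra.lift k fun j => χ i j • ι k j

@[simp] lemma kap_ι (i j : I) : kap χ i (ι k j) = χ i j • ι k j := by simp [kap]

lemma kap_comm (i j : I) (x : FreeAlgebra k I) :
    kap χ i (kap χ j x) = kap χ j (kap χ i x) := by
  have : (kap χ i).comp (kap χ j) = (kap χ j).comp (kap χ i) := by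
    ext l; simp [smul_smul, mul_comm]
  exact DFunLike.congr_fun this x

/-- The counit of the free algebra. -/
def eps (k : Type) [Field k] (I : Type) : FreeAlgebra k I →ₐ[k] k :=
  FreeAlgebra.lift k fun _ => 0

@[simp] lemma eps_ι (i : I) : eps k I (ι k i) = 0 := by simp [eps]

@[simp] lemma eps_kap (i : I) (x : FreeAlgebra k I) : eps k I (kap χ i x) = eps k I x := by
  have : (eps k I).comp (kap χ i) = eps k I := by ext l; simp
  exact DFunLike.congr_fun this x

/-- The right skew derivation on words. -/
def prWord (i : I) : List I → FreeAlgebra k I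
  | [] => 0
  | j :: l => ι k j * prWord i l + if j = i then kap χ i (mon k l) else 0

/-- The right skew derivation, `pr (x y) = x pr y + pr x κ(y)`. -/
def pr (i : I) : FreeAlgebra k I →ₗ[k] FreeAlgebra k I := ofWords (prWord χ i)

@[simp] lemma pr_one (i : I) : pr χ i 1 = 0 := by
  rw [← mon_nil, pr, ofWords_mon, prWord]

lemma pr_ι_mul (i j : I) (x : FreeAlgebra k I) :
    pr χ i (ι k j * x) = ι k j * pr χ i x + if j = i then kap χ i x else 0 := by
  have : pr χ i ∘ₗ LinearMap.mulLeft k (ι k j) = LinearMap.mulLeft k (ι k j) ∘ₗ pr χ i +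
      (if j = i then (kap χ i).toLinearMap else 0) := by
    refine linearMap_ext fun l => ?_
    simp only [LinearMap.comp_apply, LinearMap.mulLeft_apply, ← mon_cons, LinearMap.add_apply]
    rw [pr, ofWords_mon, ofWords_mon, prWord]
    split_ifs <;> simp
  have h := DFunLike.congr_fun this x
  simp only [LinearMap.comp_apply, LinearMap.mulLeft_apply, LinearMap.add_apply] at h
  rw [h]; split_ifs <;> simp

lemma pr_mul (i : I) (x y : FreeAlgebra k I) :
    pr χ i (x * y) = x * pr χ i y + pr χ i x * kap χ i y := by
  induction x using word_induction with
  | h1 => simp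
  | hadd a b ha hb => simp only [add_mul, map_add, ha, hb]; abel
  | hsmul c a ha => simp [ha]
  | hmul j a ha =>
    rw [mul_assoc, pr_ι_mul, ha, pr_ι_mul]
    split_ifs <;> simp [mul_add, add_mul, mul_assoc, add_assoc]

@[simp] lemma pr_ι (i j : I) : pr χ i (ι k j) = if j = i then 1 else 0 := by
  have := pr_ι_mul χ i j 1
  simpa using this

lemma pr_kap (i j : I) (x : FreeAlgebra k I) :
    pr χ i (kap χ j x) = χ j i • kap χ j (pr χ i x) := by
  induction x using word_induction with
  | h1 => simp
  | hadd a b ha hb => simp [ha, hb]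
  | hsmul c a ha => simp [ha, smul_comm c]
  | hmul l a ha =>
    simp only [map_mul, kap_ι, smul_mul_assoc, map_smul, pr_ι_mul, ha, map_add]
    split_ifs with h
    · subst h; rw [kap_comm χ l j]; simp [smul_add, smul_smul]
    · simp [smul_smul, mul_comm]

/-- The left skew derivation on words. -/
def plWord (i : I) : List I → FreeAlgebra k I
  | [] => 0
  | j :: l => (if j = i then mon k l else 0) + χ i j • (ι k j * plWord i l)

/-- The left skew derivation, `pl (x y) = pl x y + κ(x) pl y`. -/
def pl (i : I) : FreeAlgebra k I →ₗ[k] FreeAlgebra k I := ofWords (plWord χ i)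

@[simp] lemma pl_one (i : I) : pl χ i 1 = 0 := by
  rw [← mon_nil, pl, ofWords_mon, plWord]

lemma pl_ι_mul (i j : I) (x : FreeAlgebra k I) :
    pl χ i (ι k j * x) = (if j = i then x else 0) + χ i j • (ι k j * pl χ i x) := by
  have : pl χ i ∘ₗ LinearMap.mulLeft k (ι k j) =
      (if j = i then LinearMap.id else 0) +
        χ i j • LinearMap.mulLeft k (ι k j) ∘ₗ pl χ i := by
    refine linearMap_ext fun l => ?_
    simp only [LinearMap.comp_apply, LinearMap.mulLeft_apply, ← mon_cons, LinearMap.add_apply,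
      LinearMap.smul_apply]
    rw [pl, ofWords_mon, ofWords_mon, plWord]
    split_ifs <;> simp
  have h := DFunLike.congr_fun this x
  simp only [LinearMap.comp_apply, LinearMap.mulLeft_apply, LinearMap.add_apply,
    LinearMap.smul_apply] at h
  rw [h]; split_ifs <;> simp

lemma pl_mul (i : I) (x y : FreeAlgebra k I) :
    pl χ i (x * y) = pl χ i x * y + kap χ i x * pl χ i y := by
  induction x using word_induction with
  | h1 => simp
  | hadd a b ha hb => simp only [add_mul, map_add, ha, hb]; abel
  | hsmul c a ha => simp [ha]
  | hmul j a ha =>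
    rw [mul_assoc, pl_ι_mul, ha, pl_ι_mul]
    split_ifs <;> simp [mul_add, add_mul, mul_assoc, add_assoc]

@[simp] lemma pl_ι (i j : I) : pl χ i (ι k j) = if j = i then 1 else 0 := by
  have := pl_ι_mul χ i j 1
  simpa using this

lemma pl_kap (i j : I) (x : FreeAlgebra k I) :
    pl χ i (kap χ j x) = χ j i • kap χ j (pl χ i x) := by
  induction x using word_induction with
  | h1 => simp
  | hadd a b ha hb => simp [ha, hb]
  | hsmul c a ha => simp [ha, smul_comm c]
  | hmul l a ha =>
    simp only [map_mul, kap_ι, smul_mul_assoc, map_smul, pl_ι_mul, ha, map_add]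
    split_ifs with h
    · subst h; simp [smul_add, smul_smul, mul_comm]
    · simp [smul_smul, mul_comm, mul_left_comm]

end Derivations

section Form

variable {k : Type} [Field k] (χ : I → I → k) (ζ : I → k)

open FreeAlgebra (ι)

/-- The functional `x ↦ ⟨x, w⟩` attached to a word `w`. -/
def formWord : List I → FreeAlgebra k I →ₗ[k] k
  | [] => (eps k I).toLinearMap
  | i :: l => ζ i • formWord l ∘ₗ pr χ i

/-- The bilinear form with `⟨x, 1⟩ = ε x` and `⟨x, f_i y⟩ = ζ_i ⟨pr_i x, y⟩`;
`form χ ζ y x` stands for `⟨x, y⟩`. -/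
def form : FreeAlgebra k I →ₗ[k] FreeAlgebra k I →ₗ[k] k := ofWords (formWord χ ζ)

@[simp] lemma form_one (x : FreeAlgebra k I) : form χ ζ 1 x = eps k I x := by
  rw [← mon_nil, form, ofWords_mon, formWord]; rfl

lemma form_ι_mul (i : I) (y x : FreeAlgebra k I) :
    form χ ζ (ι k i * y) x = ζ i * form χ ζ y (pr χ i x) := by
  have : (form χ ζ) ∘ₗ LinearMap.mulLeft k (ι k i) =
      ζ i • (LinearMap.lcomp k k (pr χ i)) ∘ₗ form χ ζ := by
    refine linearMap_ext fun l => ?_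
    simp only [LinearMap.comp_apply, LinearMap.mulLeft_apply, ← mon_cons, LinearMap.smul_apply]
    rw [form, ofWords_mon, ofWords_mon, formWord]
    rfl
  exact DFunLike.congr_fun (DFunLike.congr_fun this y) x

lemma form_kap (j : I) (y x : FreeAlgebra k I) :
    form χ ζ y (kap χ j x) = form χ ζ (kap χ j y) x := by
  induction y using word_induction generalizing x with
  | h1 => simp
  | hadd a b ha hb => simp [ha, hb]
  | hsmul c a ha => simp [ha]
  | hmul i y ih =>
    simp only [map_mul, kap_ι, smul_mul_assoc, map_smul, LinearMap.smul_apply, form_ι_mul,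
      pr_kap, ih, smul_eq_mul]
    ring

lemma form_left_ι_mul (i : I) (y x : FreeAlgebra k I) :
    form χ ζ y (ι k i * x) = ζ i * form χ ζ (pr χ i y) x := by
  induction y using word_induction generalizing x with
  | h1 => simp
  | hadd a b ha hb => simp [ha, hb, mul_add]
  | hsmul c a ha => simp [ha]; ring
  | hmul j y ih =>
    simp only [form_ι_mul, pr_ι_mul, map_add, LinearMap.add_apply, ih]
    by_cases h : i = j
    · subst h; simp [form_kap, mul_add]
    · simp [h, Ne.symm h]; ring

lemma form_symm (x y : FreeAlgebra k I) : form χ ζ y x = form χ ζ x y := by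
  induction y using word_induction generalizing x with
  | h1 =>
    simp only [form_one]
    induction x using word_induction with
    | h1 => simp
    | hadd a b ha hb => simp [ha, hb]
    | hsmul c a ha => simp [ha]
    | hmul i x ih => simp [form_ι_mul]
  | hadd a b ha hb => simp [ha, hb]
  | hsmul c a ha => simp [ha]
  | hmul i y ih => rw [form_ι_mul, ih, form_left_ι_mul]

variable (hχ : ∀ i j, χ i j = χ j i)
include hχ

lemma form_left_mul_ι (i : I) (y x : FreeAlgebra k I) :
    form χ ζ y (x * ι k i) = ζ i * form χ ζ (pl χ i y) x := by
  induction y using word_induction generalizing x with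
  | h1 => simp
  | hadd a b ha hb => simp [ha, hb, mul_add]
  | hsmul c a ha => simp [ha]; ring
  | hmul j y ih =>
    rw [form_ι_mul, pr_mul, pl_ι_mul]
    by_cases h : i = j
    · subst h; simp [ih, form_ι_mul, mul_add]
    · simp [h, Ne.symm h, ih, form_ι_mul, hχ j i]; ring

end Form

section Radical

variable {k : Type} [Field k] (χ : I → I → k) (ζ : I → k)

open FreeAlgebra (ι)

/-- The radical of the form. -/
def rad : Submodule k (FreeAlgebra k I) := LinearMap.ker (form χ ζ)

lemma mem_rad {x : FreeAlgebra k I} : x ∈ rad χ ζ ↔ ∀ y, form χ ζ y x = 0 := by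
  simp only [rad, LinearMap.mem_ker, LinearMap.ext_iff, LinearMap.zero_apply, form_symm χ ζ x]

variable {χ ζ} (hζ : ∀ i, ζ i ≠ 0)
include hζ

lemma pr_mem_rad {x : FreeAlgebra k I} (hx : x ∈ rad χ ζ) (i : I) : pr χ i x ∈ rad χ ζ := by
  rw [mem_rad] at hx ⊢
  intro y
  have := hx (ι k i * y)
  rw [form_ι_mul] at this
  exact (mul_eq_zero.mp this).resolve_left (hζ i)

lemma pl_mem_rad (hχ : ∀ i j, χ i j = χ j i) {x : FreeAlgebra k I} (hx : x ∈ rad χ ζ) (i : I) :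
    pl χ i x ∈ rad χ ζ := by
  rw [mem_rad] at hx ⊢
  intro y
  have := hx (y * ι k i)
  rw [form_symm, form_left_mul_ι χ ζ hχ] at this
  rw [form_symm]
  exact (mul_eq_zero.mp this).resolve_left (hζ i)

end Radical

end BraidedFree

namespace BraidedFree

section Weights

variable {k : Type} [Field k]

open FreeAlgebra (ι)

/-- The weight of a word. -/
def wtw (l : List I) : I →₀ ℤ := (l.map fun i => Finsupp.single i (1 : ℤ)).sum

@[simp] lemma wtw_nil : wtw ([] : List I) = 0 := rfl

@[simp] lemma wtw_cons (i : I) (l : List I) : wtw (i :: l) = Finsupp.single i 1 + wtw l := by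
  simp [wtw]

/-- The weight spaces of the free algebra. -/
def Fw (k : Type) [Field k] {I : Type} (γ : I →₀ ℤ) : Submodule k (FreeAlgebra k I) :=
  Submodule.span k (mon k '' {l | wtw l = γ})

lemma mon_mem_Fw (l : List I) : mon k l ∈ Fw k (wtw l) :=
  Submodule.subset_span ⟨l, rfl, rfl⟩

lemma one_mem_Fw : (1 : FreeAlgebra k I) ∈ Fw k (0 : I →₀ ℤ) := mon_mem_Fw []

lemma Fw_induction {γ : I →₀ ℤ} {P : FreeAlgebra k I → Prop}
    (hw : ∀ l, wtw l = γ → P (mon k l)) (h0 : P 0)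
    (hadd : ∀ x y, P x → P y → P (x + y)) (hsmul : ∀ (c : k) x, P x → P (c • x))
    {x : FreeAlgebra k I} (hx : x ∈ Fw k γ) : P x := by
  induction hx using Submodule.span_induction with
  | mem x hx => obtain ⟨l, hl, rfl⟩ := hx; exact hw l hl
  | zero => exact h0
  | add x y _ _ hx hy => exact hadd x y hx hy
  | smul c x _ hx => exact hsmul c x hx

lemma mon_induction {P : FreeAlgebra k I → Prop} (hw : ∀ l, P (mon k l)) (h0 : P 0)
    (hadd : ∀ x y, P x → P y → P (x + y)) (hsmul : ∀ (c : k) x, P x → P (c • x))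
    (x : FreeAlgebra k I) : P x := by
  have hx : x ∈ Submodule.span k (Set.range (mon k (I := I))) := by
    induction x using word_induction with
    | h1 => exact Submodule.subset_span ⟨[], rfl⟩
    | hadd x y hx hy => exact add_mem hx hy
    | hsmul c x hx => exact Submodule.smul_mem _ _ hx
    | hmul i x hx =>
      induction hx using Submodule.span_induction with
      | mem x hx =>
        obtain ⟨l, rfl⟩ := hx
        exact Submodule.subset_span ⟨i :: l, mon_cons i l⟩
      | zero => simp
      | add x y _ _ hx hy => rw [mul_add]; exact add_mem hx hy
      | smul c x _ hx => rw [mul_smul_comm]; exact Submodule.smul_mem _ _ hx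
  induction hx using Submodule.span_induction with
  | mem x hx => obtain ⟨l, rfl⟩ := hx; exact hw l
  | zero => exact h0
  | add x y _ _ hx hy => exact hadd x y hx hy
  | smul c x _ hx => exact hsmul c x hx

lemma map_mem_of_mon {γ : I →₀ ℤ} {V : Type*} [AddCommGroup V] [Module k V]
    (f : FreeAlgebra k I →ₗ[k] V) (W : Submodule k V)
    (hw : ∀ l, wtw l = γ → f (mon k l) ∈ W) {x : FreeAlgebra k I} (hx : x ∈ Fw k γ) :
    f x ∈ W := by
  refine Fw_induction (P := fun x => f x ∈ W) hw (by simp) (fun x y hx hy => ?_)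
    (fun c x hx => ?_) hx
  · rw [map_add]; exact add_mem hx hy
  · rw [map_smul]; exact W.smul_mem c hx

lemma ι_mul_mem_Fw {γ : I →₀ ℤ} {x : FreeAlgebra k I} (hx : x ∈ Fw k γ) (i : I) :
    ι k i * x ∈ Fw k (Finsupp.single i 1 + γ) := by
  refine map_mem_of_mon (LinearMap.mulLeft k (ι k i)) _ (fun l hl => ?_) hx
  subst hl
  simpa using mon_mem_Fw (k := k) (i :: l)

lemma mul_mem_Fw {γ δ : I →₀ ℤ} {x y : FreeAlgebra k I} (hx : x ∈ Fw k γ) (hy : y ∈ Fw k δ) :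
    x * y ∈ Fw k (γ + δ) := by
  refine map_mem_of_mon (LinearMap.mulRight k y) _ (fun l hl => ?_) hx
  subst hl
  clear hx
  rw [LinearMap.mulRight_apply]
  induction l with
  | nil => simpa using hy
  | cons i l ih => simpa [mul_assoc, add_assoc] using ι_mul_mem_Fw ih i

lemma ι_mem_Fw (i : I) : ι k i ∈ Fw k (Finsupp.single i 1) := by
  simpa using mon_mem_Fw (k := k) [i]

/-- The operator acting on the weight space of weight `γ` by the scalar `g γ`. -/
def sc (g : (I →₀ ℤ) → k) : FreeAlgebra k I →ₗ[k] FreeAlgebra k I :=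
  ofWords fun l => g (wtw l) • mon k l

@[simp] lemma sc_mon (g : (I →₀ ℤ) → k) (l : List I) :
    sc g (mon k l) = g (wtw l) • mon k l := by simp [sc]

lemma sc_single_mem_Fw (γ : I →₀ ℤ) (x : FreeAlgebra k I) :
    sc (Pi.single γ (1 : k)) x ∈ Fw k γ := by
  induction x using mon_induction with
  | hw l =>
    rw [sc_mon]
    by_cases h : wtw l = γ
    · exact Submodule.smul_mem _ _ (h ▸ mon_mem_Fw l)
    · simp [Pi.single_eq_of_ne h]
  | h0 => simp
  | hadd x y hx hy => rw [map_add]; exact add_mem hx hy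
  | hsmul c x hx => rw [map_smul]; exact Submodule.smul_mem _ _ hx

lemma exists_sc_eq_sum (x : FreeAlgebra k I) : ∃ s : Finset (I →₀ ℤ), ∀ t, s ⊆ t →
    ∀ g : (I →₀ ℤ) → k, sc g x = ∑ γ ∈ t, g γ • sc (Pi.single γ (1 : k)) x := by
  induction x using mon_induction with
  | hw l =>
    refine ⟨{wtw l}, fun t ht g => ?_⟩
    rw [Finset.sum_eq_single_of_mem (wtw l) (ht (by simp))]
    · simp
    · intro γ _ h
      simp [Pi.single_eq_of_ne h.symm]
  | h0 => exact ⟨∅, by simp⟩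
  | hadd x y hx hy =>
    classical
    obtain ⟨s, hs⟩ := hx
    obtain ⟨s', hs'⟩ := hy
    refine ⟨s ∪ s', fun t ht g => ?_⟩
    rw [map_add, hs t (Finset.union_subset_left ht) g, hs' t (Finset.union_subset_right ht) g,
      ← Finset.sum_add_distrib]
    simp
  | hsmul c x hx =>
    obtain ⟨s, hs⟩ := hx
    refine ⟨s, fun t ht g => ?_⟩
    rw [map_smul, hs t ht g, Finset.smul_sum]
    exact Finset.sum_congr rfl fun γ _ => by rw [map_smul, smul_comm]

lemma sc_one_apply (x : FreeAlgebra k I) : sc (fun _ => (1 : k)) x = x := by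
  have : sc (fun _ => (1 : k)) = (LinearMap.id : FreeAlgebra k I →ₗ[k] _) :=
    linearMap_ext fun l => by simp
  rw [this]; rfl

variable (χ : I → I → k) (ζ : I → k)

lemma kap_mon (i : I) (l : List I) : kap χ i (mon k l) = (l.map (χ i)).prod • mon k l := by
  induction l with
  | nil => simp
  | cons j l ih => simp [ih, smul_smul, mul_comm]

lemma kap_mem_Fw (i : I) {γ : I →₀ ℤ} {x : FreeAlgebra k I} (hx : x ∈ Fw k γ) :
    kap χ i x ∈ Fw k γ := by
  refine map_mem_of_mon (kap χ i).toLinearMap _ (fun l hl => ?_) hx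
  subst hl
  rw [AlgHom.toLinearMap_apply, kap_mon]
  exact Submodule.smul_mem _ _ (mon_mem_Fw l)

lemma pr_mem_Fw (i : I) {γ : I →₀ ℤ} {x : FreeAlgebra k I} (hx : x ∈ Fw k γ) :
    pr χ i x ∈ Fw k (γ - Finsupp.single i 1) := by
  refine map_mem_of_mon (pr χ i) _ (fun l hl => ?_) hx
  subst hl
  clear hx
  induction l with
  | nil => simp
  | cons j l ih =>
    rw [mon_cons, pr_ι_mul, wtw_cons]
    refine add_mem ?_ ?_
    · rw [add_sub_assoc]; exact ι_mul_mem_Fw ih j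
    · split_ifs with h
      · subst h; rw [add_sub_cancel_left]; exact kap_mem_Fw χ j (mon_mem_Fw l)
      · exact zero_mem _

lemma pl_mem_Fw (i : I) {γ : I →₀ ℤ} {x : FreeAlgebra k I} (hx : x ∈ Fw k γ) :
    pl χ i x ∈ Fw k (γ - Finsupp.single i 1) := by
  refine map_mem_of_mon (pl χ i) _ (fun l hl => ?_) hx
  subst hl
  clear hx
  induction l with
  | nil => simp
  | cons j l ih =>
    rw [mon_cons, pl_ι_mul, wtw_cons]
    refine add_mem ?_ ?_
    · split_ifs with h
      · subst h; rw [add_sub_cancel_left]; exact mon_mem_Fw l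
      · exact zero_mem _
    · rw [add_sub_assoc]; exact Submodule.smul_mem _ _ (ι_mul_mem_Fw ih j)

/-- The height of a weight. -/
def ht (γ : I →₀ ℤ) : ℤ := γ.sum fun _ a => a

lemma ht_add (γ δ : I →₀ ℤ) : ht (γ + δ) = ht γ + ht δ :=
  Finsupp.sum_add_index' (fun _ => rfl) fun _ _ _ => rfl

@[simp] lemma ht_single (i : I) (a : ℤ) : ht (Finsupp.single i a) = a :=
  Finsupp.sum_single_index rfl

lemma ht_sub (γ δ : I →₀ ℤ) : ht (γ - δ) = ht γ - ht δ := by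
  have := ht_add (γ - δ) δ
  rw [sub_add_cancel] at this
  omega

lemma ht_wtw (l : List I) : ht (wtw l) = l.length := by
  induction l with
  | nil => rfl
  | cons i l ih => rw [wtw_cons, ht_add, ih]; simp [add_comm]

lemma form_eq_zero_of_ne {γ δ : I →₀ ℤ} (h : γ ≠ δ) {x y : FreeAlgebra k I}
    (hx : x ∈ Fw k γ) (hy : y ∈ Fw k δ) : form χ ζ y x = 0 := by
  have : (form χ ζ).flip x y ∈ (⊥ : Submodule k k) := by
    refine map_mem_of_mon ((form χ ζ).flip x) _ (fun l hl => ?_) hy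
    subst hl
    clear hy
    rw [Submodule.mem_bot, LinearMap.flip_apply]
    induction l generalizing γ x with
    | nil =>
      rw [mon_nil, form_one]
      have : x ∈ LinearMap.ker (eps k I).toLinearMap := by
        refine map_mem_of_mon LinearMap.id _ (fun l hl => ?_) hx
        cases l with
        | nil => exact absurd hl.symm h
        | cons i l => simp
      exact this
    | cons i l ih =>
      have h' : γ - Finsupp.single i 1 ≠ wtw l := fun h' => h (by rw [wtw_cons, ← h']; abel)
      rw [mon_cons, form_ι_mul, ih (pr_mem_Fw χ i hx) h', mul_zero]
  exact this

lemma form_sc (g : (I →₀ ℤ) → k) (y x : FreeAlgebra k I) :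
    form χ ζ y (sc g x) = form χ ζ (sc g y) x := by
  have h : ∀ l l' : List I, form χ ζ (mon k l) (sc g (mon k l')) =
      form χ ζ (sc g (mon k l)) (mon k l') := by
    intro l l'
    rw [sc_mon, sc_mon, map_smul, map_smul, LinearMap.smul_apply]
    by_cases h : wtw l' = wtw l
    · rw [h]
    · rw [form_eq_zero_of_ne χ ζ h (mon_mem_Fw l') (mon_mem_Fw l)]; simp
  induction y using mon_induction with
  | hw l =>
    induction x using mon_induction with
    | hw l' => exact h l l'
    | h0 => simp
    | hadd x y hx hy => simp only [map_add, hx, hy]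
    | hsmul c x hx => simp only [map_smul, hx]
  | h0 => simp
  | hadd x y hx hy => simp only [map_add, hx, hy, LinearMap.add_apply]
  | hsmul c x hx => simp only [map_smul, hx, LinearMap.smul_apply]

variable {χ ζ}

lemma sc_mem_rad (g : (I →₀ ℤ) → k) {x : FreeAlgebra k I} (hx : x ∈ rad χ ζ) :
    sc g x ∈ rad χ ζ := by
  rw [mem_rad] at hx ⊢
  intro y; rw [form_sc]; exact hx _

lemma sc_mem_of_rad {W : Submodule k (FreeAlgebra k I)} (g : (I →₀ ℤ) → k)
    (h : ∀ γ, g γ ≠ 0 → rad χ ζ ⊓ Fw k γ ≤ W) {x : FreeAlgebra k I} (hx : x ∈ rad χ ζ) :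
    sc g x ∈ W := by
  obtain ⟨s, hs⟩ := exists_sc_eq_sum x
  rw [hs s le_rfl g]
  refine sum_mem fun γ _ => ?_
  by_cases hγ : g γ = 0
  · simp [hγ]
  · exact W.smul_mem _ (h γ hγ ⟨sc_mem_rad _ hx, sc_single_mem_Fw γ x⟩)

end Weights

end BraidedFree

namespace BraidedFree

section Antipode

variable {k : Type} [Field k] (χ : I → I → k) (ζ : I → k)

open FreeAlgebra (ι)

/-- The braided antipode on words. -/
def antWord : List I → FreeAlgebra k I
  | [] => 1
  | j :: l => -(kap χ j (antWord l) * ι k j)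

/-- The braided antipode of the free algebra. -/
def ant : FreeAlgebra k I →ₗ[k] FreeAlgebra k I := ofWords (antWord χ)

@[simp] lemma ant_one : ant χ (1 : FreeAlgebra k I) = 1 := by
  rw [← mon_nil, ant, ofWords_mon, antWord, mon_nil]

lemma ant_ι_mul (j : I) (x : FreeAlgebra k I) :
    ant χ (ι k j * x) = -(kap χ j (ant χ x) * ι k j) := by
  have : ant χ ∘ₗ LinearMap.mulLeft k (ι k j) =
      -(LinearMap.mulRight k (ι k j) ∘ₗ (kap χ j).toLinearMap ∘ₗ ant χ) := by
    refine linearMap_ext fun l => ?_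
    simp only [LinearMap.comp_apply, LinearMap.mulLeft_apply, ← mon_cons, LinearMap.neg_apply]
    rw [ant, ofWords_mon, ofWords_mon, antWord]
    rfl
  exact DFunLike.congr_fun this x

lemma ant_kap (j : I) (x : FreeAlgebra k I) : ant χ (kap χ j x) = kap χ j (ant χ x) := by
  induction x using word_induction with
  | h1 => simp
  | hadd a b ha hb => simp [ha, hb]
  | hsmul c a ha => simp [ha]
  | hmul i a ha => simp [ant_ι_mul, ha, kap_comm χ i j]

lemma ant_mul_ι (hχ : ∀ i j, χ i j = χ j i) (j : I) (x : FreeAlgebra k I) :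
    ant χ (x * ι k j) = -(ι k j * ant χ (kap χ j x)) := by
  induction x using word_induction with
  | h1 => simpa using ant_ι_mul χ j 1
  | hadd a b ha hb => simp only [add_mul, map_add, ha, hb, mul_add, neg_add]
  | hsmul c a ha => simp [ha]
  | hmul i a ha =>
    rw [mul_assoc, ant_ι_mul, ha]
    simp [ant_ι_mul, mul_assoc, hχ i j]

lemma ant_ant_ι_mul (hχ : ∀ i j, χ i j = χ j i) (j : I) (x : FreeAlgebra k I) :
    ant χ (ant χ (ι k j * x)) = ι k j * kap χ j (kap χ j (ant χ (ant χ x))) := by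
  rw [ant_ι_mul, map_neg, ant_mul_ι χ hχ, neg_neg, ant_kap, ant_kap]

lemma pr_ant (hχ : ∀ i j, χ i j = χ j i) (j : I) (x : FreeAlgebra k I) :
    pr χ j (ant χ x) = -ant χ (kap χ j (pl χ j x)) := by
  induction x using word_induction with
  | h1 => simp
  | hadd a b ha hb => simp only [map_add, ha, hb, neg_add]
  | hsmul c a ha => simp [ha]
  | hmul l x ih =>
    rw [ant_ι_mul, map_neg, pr_mul, pr_kap, ih, pl_ι_mul]
    by_cases h : l = j
    · subst h
      simp [ant_ι_mul, ant_kap, smul_smul]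
    · simp [h, ant_ι_mul, ant_kap, smul_smul, hχ l j, kap_comm χ l j]

lemma form_ant (hχ : ∀ i j, χ i j = χ j i) (y x : FreeAlgebra k I) :
    form χ ζ y (ant χ x) = form χ ζ (ant χ y) x := by
  induction x using word_induction generalizing y with
  | h1 =>
    rw [ant_one, form_symm, form_one, form_symm, form_one]
    induction y using word_induction with
    | h1 => simp
    | hadd a b ha hb => simp only [map_add, ha, hb]
    | hsmul c a ha => simp only [map_smul, ha]
    | hmul i a ha => simp [ant_ι_mul]
  | hadd a b ha hb => simp only [map_add, ha, hb]
  | hsmul c a ha => simp only [map_smul, ha]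
  | hmul i x ih =>
    rw [ant_ι_mul, map_neg, form_left_mul_ι χ ζ hχ, form_kap, ih, form_left_ι_mul,
      pr_ant χ hχ]
    simp

lemma ant_mem_rad (hχ : ∀ i j, χ i j = χ j i) {x : FreeAlgebra k I} (hx : x ∈ rad χ ζ) :
    ant χ x ∈ rad χ ζ := by
  rw [mem_rad] at hx ⊢
  intro y; rw [form_ant χ ζ hχ]; exact hx _

lemma ant_mem_Fw {γ : I →₀ ℤ} {x : FreeAlgebra k I} (hx : x ∈ Fw k γ) : ant χ x ∈ Fw k γ := by
  refine map_mem_of_mon (ant χ) _ (fun l hl => ?_) hx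
  subst hl
  clear hx
  induction l with
  | nil => simpa using one_mem_Fw
  | cons j l ih =>
    rw [mon_cons, ant_ι_mul, wtw_cons, add_comm]
    exact neg_mem (mul_mem_Fw (kap_mem_Fw χ j ih) (ι_mem_Fw j))

/-- The eigenvalue of the square of the antipode on a word. -/
def twist : List I → k
  | [] => 1
  | j :: l => twist l * ((l.map (χ j)).prod) ^ 2

lemma ant_ant_mon (hχ : ∀ i j, χ i j = χ j i) (l : List I) :
    ant χ (ant χ (mon k l)) = twist χ l • mon k l := by
  induction l with
  | nil => simp [twist]
  | cons j l ih =>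
    rw [mon_cons, ant_ant_ι_mul χ hχ, ih, map_smul, map_smul, kap_mon, map_smul, kap_mon,
      twist]
    simp [smul_smul, sq]

end Antipode

section Coproduct

variable {k : Type} [Field k] (χ : I → I → k) (ζ : I → k)

open FreeAlgebra (ι)
open scoped TensorProduct

/-- Left multiplication by `f_j ⊗ 1 + 1 ⊗ f_j` in the twisted tensor square. -/
def copStep (j : I) : FreeAlgebra k I ⊗[k] FreeAlgebra k I →ₗ[k]
    FreeAlgebra k I ⊗[k] FreeAlgebra k I :=
  TensorProduct.map (LinearMap.mulLeft k (ι k j)) LinearMap.id +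
    TensorProduct.map (kap χ j).toLinearMap (LinearMap.mulLeft k (ι k j))

@[simp] lemma copStep_tmul (j : I) (x y : FreeAlgebra k I) :
    copStep χ j (x ⊗ₜ y) = (ι k j * x) ⊗ₜ y + kap χ j x ⊗ₜ (ι k j * y) := by
  simp [copStep]

/-- The braided coproduct on words. -/
def copWord : List I → FreeAlgebra k I ⊗[k] FreeAlgebra k I
  | [] => 1 ⊗ₜ 1
  | j :: l => copStep χ j (copWord l)

/-- The braided coproduct of the free algebra. -/
def cop : FreeAlgebra k I →ₗ[k] FreeAlgebra k I ⊗[k] FreeAlgebra k I := ofWords (copWord χ)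

@[simp] lemma cop_one : cop χ (1 : FreeAlgebra k I) = 1 ⊗ₜ 1 := by
  rw [← mon_nil, cop, ofWords_mon, copWord, mon_nil]

lemma cop_ι_mul (j : I) (x : FreeAlgebra k I) : cop χ (ι k j * x) = copStep χ j (cop χ x) := by
  have : cop χ ∘ₗ LinearMap.mulLeft k (ι k j) = copStep χ j ∘ₗ cop χ := by
    refine linearMap_ext fun l => ?_
    simp only [LinearMap.comp_apply, LinearMap.mulLeft_apply, ← mon_cons]
    rw [cop, ofWords_mon, ofWords_mon, copWord]
  exact DFunLike.congr_fun this x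

lemma mul_ant_copStep (j : I) (t : FreeAlgebra k I ⊗[k] FreeAlgebra k I) :
    LinearMap.mul' k _ (TensorProduct.map (ant χ) LinearMap.id (copStep χ j t)) = 0 := by
  induction t with
  | zero => simp
  | add a b ha hb => simp only [map_add, ha, hb, add_zero]
  | tmul x y => simp [ant_ι_mul, ant_kap, mul_assoc]

lemma cop_kap (i : I) (x : FreeAlgebra k I) :
    cop χ (kap χ i x) =
      TensorProduct.map (kap χ i).toLinearMap (kap χ i).toLinearMap (cop χ x) := by
  induction x using word_induction with
  | h1 => simp
  | hadd a b ha hb => simp only [map_add, ha, hb]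
  | hsmul c a ha => simp only [map_smul, ha]
  | hmul j x ih =>
    simp only [map_mul, kap_ι, smul_mul_assoc, map_smul, cop_ι_mul, ih]
    generalize cop χ x = t
    induction t with
    | zero => simp
    | add a b ha hb => simp only [map_add, smul_add, ha, hb]
    | tmul x y =>
      simp [TensorProduct.smul_tmul', TensorProduct.tmul_smul, kap_comm χ i j]

lemma lTensor_pr_cop (i : I) (x : FreeAlgebra k I) :
    TensorProduct.map LinearMap.id (pr χ i) (cop χ x) = cop χ (pr χ i x) := by
  induction x using word_induction with
  | h1 => simp
  | hadd a b ha hb => simp only [map_add, ha, hb]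
  | hsmul c a ha => simp only [map_smul, ha]
  | hmul j x ih =>
    have key : ∀ t, TensorProduct.map LinearMap.id (pr χ i) (copStep χ j t) =
        copStep χ j (TensorProduct.map LinearMap.id (pr χ i) t) +
          if j = i then TensorProduct.map (kap χ i).toLinearMap (kap χ i).toLinearMap t
            else 0 := by
      intro t
      induction t with
      | zero => simp
      | add a b ha hb => split_ifs at * <;> simp only [map_add, ha, hb] <;> abel
      | tmul x y =>
        by_cases h : j = i
        · subst h; simp [pr_ι_mul, TensorProduct.tmul_add, add_assoc]
        · simp [pr_ι_mul, h]
    rw [cop_ι_mul, key, ih, pr_ι_mul, map_add, cop_ι_mul]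
    split_ifs <;> simp [cop_kap]

/-- Contraction of the second tensor factor with a functional. -/
def contr {V W : Type} [AddCommGroup V] [Module k V] [AddCommGroup W] [Module k W]
    (f : W →ₗ[k] k) : V ⊗[k] W →ₗ[k] V :=
  (TensorProduct.rid k V).toLinearMap ∘ₗ TensorProduct.map LinearMap.id f

@[simp] lemma contr_tmul {V W : Type} [AddCommGroup V] [Module k V] [AddCommGroup W]
    [Module k W] (f : W →ₗ[k] k) (x : V) (y : W) : contr f (x ⊗ₜ[k] y) = f y • x := by
  simp [contr]

lemma contr_eps_cop (x : FreeAlgebra k I) : contr (eps k I).toLinearMap (cop χ x) = x := by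
  induction x using word_induction with
  | h1 => simp
  | hadd a b ha hb => simp only [map_add, ha, hb]
  | hsmul c a ha => simp only [map_smul, ha]
  | hmul j x ih =>
    have key : ∀ t, contr (eps k I).toLinearMap (copStep χ j t) =
        ι k j * contr (eps k I).toLinearMap t := by
      intro t
      induction t with
      | zero => simp
      | add a b ha hb => simp only [map_add, ha, hb, mul_add]
      | tmul x y => simp
    rw [cop_ι_mul, key, ih]

variable {χ ζ}

lemma contr_form_cop_mem_rad (hζ : ∀ i, ζ i ≠ 0) (y : FreeAlgebra k I) {x : FreeAlgebra k I}
    (hx : x ∈ rad χ ζ) : contr (form χ ζ y) (cop χ x) ∈ rad χ ζ := by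
  have hcontr : ∀ (f g : FreeAlgebra k I →ₗ[k] k) (t : FreeAlgebra k I ⊗[k] FreeAlgebra k I),
      contr (f + g) t = contr f t + contr g t := by
    intro f g t
    simp [contr, TensorProduct.map_add_right]
  have hsm : ∀ (c : k) (f : FreeAlgebra k I →ₗ[k] k)
      (t : FreeAlgebra k I ⊗[k] FreeAlgebra k I), contr (c • f) t = c • contr f t := by
    intro c f t
    simp [contr, TensorProduct.map_smul_right]
  induction y using word_induction generalizing x with
  | h1 =>
    have : form χ ζ 1 = (eps k I).toLinearMap := by ext x; simp
    rw [this, contr_eps_cop]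
    exact hx
  | hadd a b ha hb => rw [map_add, hcontr]; exact add_mem (ha hx) (hb hx)
  | hsmul c a ha => rw [map_smul, hsm]; exact Submodule.smul_mem _ _ (ha hx)
  | hmul i y ih =>
    have : form χ ζ (ι k i * y) = ζ i • (form χ ζ y ∘ₗ pr χ i) := by
      ext x; simp [form_ι_mul]
    have h2 : contr (form χ ζ y ∘ₗ pr χ i) (cop χ x) =
        contr (form χ ζ y) (cop χ (pr χ i x)) := by
      rw [← lTensor_pr_cop]
      generalize cop χ x = t
      induction t with
      | zero => simp
      | add a b ha hb => simp only [map_add, ha, hb]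
      | tmul x y => simp
    rw [this, hsm, h2]
    exact Submodule.smul_mem _ _ (ih (pr_mem_rad hζ hx i))

/-- A linear map on the tensor square vanishing on `rad ⊗ F` and on `F ⊗ rad` vanishes on every
tensor whose contractions with all `⟨·, y⟩` lie in the radical. -/
lemma map_eq_zero_of_contr_mem_rad {V : Type} [AddCommGroup V] [Module k V]
    (Φ : FreeAlgebra k I ⊗[k] FreeAlgebra k I →ₗ[k] V)
    (h₁ : ∀ r ∈ rad χ ζ, ∀ y, Φ (r ⊗ₜ y) = 0) (h₂ : ∀ x, ∀ r ∈ rad χ ζ, Φ (x ⊗ₜ r) = 0)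
    (t : FreeAlgebra k I ⊗[k] FreeAlgebra k I)
    (ht : ∀ y, contr (form χ ζ y) t ∈ rad χ ζ) : Φ t = 0 := by
  obtain ⟨s, hs⟩ := (rad χ ζ).mkQ.exists_rightInverse_of_surjective
    (LinearMap.range_eq_top.mpr (Submodule.mkQ_surjective _))
  set e : FreeAlgebra k I →ₗ[k] FreeAlgebra k I := s ∘ₗ (rad χ ζ).mkQ with he
  have he0 : ∀ x ∈ rad χ ζ, e x = 0 := by
    intro x hx
    have : (rad χ ζ).mkQ x = 0 := by simpa using hx
    rw [he, LinearMap.comp_apply, this, map_zero]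
  have hsub : ∀ x, x - e x ∈ rad χ ζ := by
    intro x
    have h := DFunLike.congr_fun hs ((rad χ ζ).mkQ x)
    rw [← Submodule.ker_mkQ (rad χ ζ), LinearMap.mem_ker, map_sub, sub_eq_zero]
    exact h.symm
  have hee : ∀ x, e (e x) = e x := by
    intro x
    have := he0 _ (hsub x)
    rw [map_sub, sub_eq_zero] at this
    exact this.symm
  have hform : ∀ y x, form χ ζ y (e x) = form χ ζ y x := by
    intro y x
    have := (mem_rad χ ζ).mp (hsub x) y
    rw [map_sub, sub_eq_zero] at this
    exact this.symm
  have hΦ : ∀ t, Φ t = Φ (TensorProduct.map e e t) := by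
    intro t
    induction t with
    | zero => simp
    | add a b ha hb => simp only [map_add, ← ha, ← hb]
    | tmul x y =>
      have e1 : x ⊗ₜ[k] y = e x ⊗ₜ e y + ((x - e x) ⊗ₜ y + e x ⊗ₜ (y - e y)) := by
        rw [TensorProduct.sub_tmul, TensorProduct.tmul_sub]; abel
      rw [e1]
      simp [h₁ _ (hsub x), h₂ _ _ (hsub y), hee]
  have hzero : TensorProduct.map e e t = 0 := by
    classical
    let b := FreeAlgebra.basisFreeMonoid k I
    apply (TensorProduct.equivFinsuppOfBasisLeft b).injective
    rw [map_zero]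
    ext1 w
    have hcoord : ∀ t : FreeAlgebra k I ⊗[k] FreeAlgebra k I,
        TensorProduct.equivFinsuppOfBasisLeft b t w =
          TensorProduct.lid k _ (TensorProduct.map (b.coord w) LinearMap.id t) := by
      intro t
      induction t with
      | zero => simp
      | add a b ha hb => simp only [map_add, Finsupp.add_apply, ha, hb]
      | tmul x y => simp
    rw [hcoord, Finsupp.coe_zero, Pi.zero_apply]
    have h3 : ∀ t : FreeAlgebra k I ⊗[k] FreeAlgebra k I,
        TensorProduct.lid k _ (TensorProduct.map (b.coord w) LinearMap.id
          (TensorProduct.map e e t)) =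
        e (TensorProduct.lid k _ (TensorProduct.map (b.coord w ∘ₗ e) LinearMap.id t)) := by
      intro t
      induction t with
      | zero => simp
      | add a b ha hb => simp only [map_add, ha, hb]
      | tmul x y => simp
    rw [h3]
    apply he0
    rw [mem_rad]
    intro y
    have h4 : ∀ t : FreeAlgebra k I ⊗[k] FreeAlgebra k I,
        form χ ζ y (TensorProduct.lid k _
          (TensorProduct.map (b.coord w ∘ₗ e) LinearMap.id t)) =
        b.coord w (e (contr (form χ ζ y) t)) := by
      intro t
      induction t with
      | zero => simp
      | add a b ha hb => simp only [map_add, ha, hb]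
      | tmul x y => simp [mul_comm]
    rw [h4, he0 _ (ht y), map_zero]
  rw [hΦ, hzero, map_zero]

end Coproduct

end BraidedFree

namespace BraidedFree

section AntipodeArgument

variable {k : Type} [Field k] (χ : I → I → k) (ζ : I → k)

open FreeAlgebra (ι)
open scoped TensorProduct

/-- Contraction of the first tensor factor with the counit. -/
def contrEps : FreeAlgebra k I ⊗[k] FreeAlgebra k I →ₗ[k] FreeAlgebra k I :=
  (TensorProduct.lid k _).toLinearMap ∘ₗ TensorProduct.map (eps k I).toLinearMap LinearMap.id

@[simp] lemma contrEps_tmul (x y : FreeAlgebra k I) :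
    contrEps (x ⊗ₜ[k] y) = eps k I x • y := by simp [contrEps]

lemma contrEps_cop (x : FreeAlgebra k I) : contrEps (cop χ x) = x := by
  induction x using word_induction with
  | h1 => simp
  | hadd a b ha hb => simp only [map_add, ha, hb]
  | hsmul c a ha => simp only [map_smul, ha]
  | hmul j x ih =>
    have key : ∀ t : FreeAlgebra k I ⊗[k] FreeAlgebra k I, contrEps (copStep χ j t) =
        ι k j * contrEps t := by
      intro t
      induction t with
      | zero => simp
      | add a b ha hb => simp only [map_add, ha, hb, mul_add]
      | tmul x y => simp
    rw [cop_ι_mul, key, ih]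

lemma cop_mon_mem (l : List I) : cop χ (mon k l) ∈
    Submodule.span k {t : FreeAlgebra k I ⊗[k] FreeAlgebra k I |
      ∃ u v : List I, u.length + v.length = l.length ∧ t = mon k u ⊗ₜ mon k v} := by
  induction l with
  | nil =>
    rw [mon_nil, cop_one]
    exact Submodule.subset_span ⟨[], [], rfl, by simp⟩
  | cons j l ih =>
    rw [mon_cons, cop_ι_mul]
    refine Submodule.span_induction
      (p := fun t _ => copStep χ j t ∈ Submodule.span k {t : FreeAlgebra k I ⊗[k] FreeAlgebra k I |
        ∃ u v : List I, u.length + v.length = (j :: l).length ∧ t = mon k u ⊗ₜ mon k v})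
      ?_ (by simp) (fun x y _ _ hx hy => ?_) (fun c x _ hx => ?_) ih
    · rintro _ ⟨u, v, h, rfl⟩
      rw [copStep_tmul, kap_mon, ← mon_cons, ← mon_cons, ← TensorProduct.smul_tmul']
      refine add_mem (Submodule.subset_span ⟨j :: u, v, ?_, rfl⟩)
        (Submodule.smul_mem _ _ (Submodule.subset_span ⟨u, j :: v, ?_, rfl⟩)) <;>
      simp only [List.length_cons] <;> omega
    · rw [map_add]; exact add_mem hx hy
    · rw [map_smul]; exact Submodule.smul_mem _ _ hx

/-- The indicator function of the weights of height strictly between `0` and `n`. -/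
def midInd (k : Type) [Field k] {I : Type} (n : ℤ) (γ : I →₀ ℤ) : k :=
  if 0 < ht γ ∧ ht γ < n then 1 else 0

lemma eps_mon (l : List I) : eps k I (mon k l) = if l = [] then 1 else 0 := by
  cases l <;> simp

lemma cop_mon_eq {l : List I} (hl : l ≠ []) :
    cop χ (mon k l) = TensorProduct.map (sc (midInd k l.length)) (sc (midInd k l.length))
      (cop χ (mon k l)) + (mon k l ⊗ₜ 1 + 1 ⊗ₜ mon k l) := by
  have key : ∀ t ∈ Submodule.span k {t : FreeAlgebra k I ⊗[k] FreeAlgebra k I |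
      ∃ u v : List I, u.length + v.length = l.length ∧ t = mon k u ⊗ₜ mon k v},
      t = TensorProduct.map (sc (midInd k l.length)) (sc (midInd k l.length)) t +
        (contr (eps k I).toLinearMap t ⊗ₜ 1 + 1 ⊗ₜ contrEps t) := by
    intro t ht
    induction ht using Submodule.span_induction with
    | mem t ht =>
      obtain ⟨u, v, h, rfl⟩ := ht
      have hl' := List.length_pos_iff.mpr hl
      rw [TensorProduct.map_tmul, sc_mon, sc_mon, contr_tmul, contrEps_tmul,
        AlgHom.toLinearMap_apply, eps_mon, eps_mon, midInd, midInd, ht_wtw, ht_wtw]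
      rcases eq_or_ne u [] with hu | hu
      · subst hu
        have hv : v ≠ [] := by rintro rfl; simp at h; omega
        simp [hv]
      · have hu' := List.length_pos_iff.mpr hu
        rcases eq_or_ne v [] with hv | hv
        · subst hv
          simp [hu]
        · have hv' := List.length_pos_iff.mpr hv
          rw [if_pos (by omega), if_pos (by omega), if_neg hv, if_neg hu]
          simp
    | zero => simp
    | add x y _ _ hx hy =>
      conv_lhs => rw [hx, hy]
      simp only [map_add, TensorProduct.add_tmul, TensorProduct.tmul_add]
      abel
    | smul c x _ hx =>
      conv_lhs => rw [hx]
      simp only [map_smul, smul_add, TensorProduct.smul_tmul', TensorProduct.tmul_smul]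
  have := key _ (cop_mon_mem χ l)
  rwa [contr_eps_cop, contrEps_cop] at this

lemma mul_ant_mid_cop {n : ℤ} (hn : 0 < n) {γ : I →₀ ℤ} (hγ : ht γ = n)
    {x : FreeAlgebra k I} (hx : x ∈ Fw k γ) :
    LinearMap.mul' k _ (TensorProduct.map (ant χ ∘ₗ sc (midInd k n)) (sc (midInd k n))
      (cop χ x)) + (x + ant χ x) = 0 := by
  have : (LinearMap.mul' k (FreeAlgebra k I) ∘ₗ
      TensorProduct.map (ant χ ∘ₗ sc (midInd k n)) (sc (midInd k n)) ∘ₗ cop χ +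
        (LinearMap.id + ant χ) : FreeAlgebra k I →ₗ[k] FreeAlgebra k I) x ∈ (⊥ : Submodule k (FreeAlgebra k I)) := by
    refine map_mem_of_mon _ _ (fun l hl => ?_) hx
    have hln : (l.length : ℤ) = n := by rw [← ht_wtw, hl, hγ]
    have hne : l ≠ [] := by rintro rfl; simp at hln; omega
    subst hln
    have h0 : LinearMap.mul' k _ (TensorProduct.map (ant χ) LinearMap.id
        (cop χ (mon k l))) = 0 := by
      obtain ⟨j, l, rfl⟩ := List.exists_cons_of_ne_nil hne
      rw [mon_cons, cop_ι_mul, mul_ant_copStep]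
    rw [cop_mon_eq χ hne, map_add, map_add] at h0
    have h1 : TensorProduct.map (ant χ ∘ₗ sc (midInd k l.length)) (sc (midInd k l.length))
        (cop χ (mon k l)) = TensorProduct.map (ant χ) LinearMap.id
          (TensorProduct.map (sc (midInd k l.length)) (sc (midInd k l.length))
            (cop χ (mon k l))) := by
      generalize cop χ (mon k l) = t
      induction t with
      | zero => simp
      | add a b ha hb => simp only [map_add, ha, hb]
      | tmul x y => simp
    rw [Submodule.mem_bot, LinearMap.add_apply, LinearMap.comp_apply, LinearMap.comp_apply, h1,
      LinearMap.add_apply]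
    rw [← h0]
    simp [add_comm]
  simpa using this

variable {χ ζ}

lemma add_ant_mem (hζ : ∀ i, ζ i ≠ 0) (hχ : ∀ i j, χ i j = χ j i)
    {J : Submodule k (FreeAlgebra k I)}
    (hJl : ∀ x y, y ∈ J → x * y ∈ J) (hJr : ∀ x y, x ∈ J → x * y ∈ J) {n : ℤ} (hn : 0 < n)
    (ih : ∀ γ, ht γ < n → rad χ ζ ⊓ Fw k γ ≤ J) {γ : I →₀ ℤ} (hγ : ht γ = n)
    {x : FreeAlgebra k I} (hxr : x ∈ rad χ ζ) (hx : x ∈ Fw k γ) : x + ant χ x ∈ J := by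
  have hmid : ∀ γ : I →₀ ℤ, midInd k n γ ≠ 0 → ht γ < n := by
    intro γ h
    by_contra h'
    exact h (if_neg fun h'' => h' h''.2)
  have hΦ : ∀ x y, (J.mkQ ∘ₗ LinearMap.mul' k _ ∘ₗ
      TensorProduct.map (ant χ ∘ₗ sc (midInd k n)) (sc (midInd k n))) (x ⊗ₜ[k] y) = 0 ↔
        ant χ (sc (midInd k n) x) * sc (midInd k n) y ∈ J := by
    intro x y
    rw [LinearMap.comp_apply, LinearMap.comp_apply, TensorProduct.map_tmul, LinearMap.mul'_apply,
      Submodule.mkQ_apply, Submodule.Quotient.mk_eq_zero, LinearMap.comp_apply]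
  have h0 := map_eq_zero_of_contr_mem_rad (χ := χ) (ζ := ζ)
    (J.mkQ ∘ₗ LinearMap.mul' k _ ∘ₗ
      TensorProduct.map (ant χ ∘ₗ sc (midInd k n)) (sc (midInd k n)))
    (fun r hr y => by
      have : sc (midInd k n) r ∈ J.comap (ant χ) :=
        sc_mem_of_rad _ (fun γ h z hz => Submodule.mem_comap.mpr (ih γ (hmid γ h)
          (Submodule.mem_inf.mpr ⟨ant_mem_rad χ ζ hχ (Submodule.mem_inf.mp hz).1,
            ant_mem_Fw χ (Submodule.mem_inf.mp hz).2⟩))) hr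
      exact (hΦ _ _).mpr (hJr _ _ (Submodule.mem_comap.mp this)))
    (fun y r hr => by
      have : sc (midInd k n) r ∈ J := sc_mem_of_rad _ (fun γ h => ih γ (hmid γ h)) hr
      exact (hΦ _ _).mpr (hJl _ _ this))
    (cop χ x) (fun y => contr_form_cop_mem_rad hζ y hxr)
  have h1 := mul_ant_mid_cop χ hn hγ hx
  rw [LinearMap.comp_apply, LinearMap.comp_apply, Submodule.mkQ_apply,
    Submodule.Quotient.mk_eq_zero] at h0
  rw [← neg_eq_of_add_eq_zero_right h1]
  exact neg_mem h0

lemma mem_of_twist_ne_one (hζ : ∀ i, ζ i ≠ 0) (hχ : ∀ i j, χ i j = χ j i)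
    {J : Submodule k (FreeAlgebra k I)}
    (hJl : ∀ x y, y ∈ J → x * y ∈ J) (hJr : ∀ x y, x ∈ J → x * y ∈ J) {n : ℤ} (hn : 0 < n)
    (ih : ∀ γ, ht γ < n → rad χ ζ ⊓ Fw k γ ≤ J) {γ : I →₀ ℤ} (hγ : ht γ = n)
    {θ : k} (hθ : ∀ l, wtw l = γ → twist χ l = θ) (hθ1 : θ ≠ 1)
    {x : FreeAlgebra k I} (hxr : x ∈ rad χ ζ) (hx : x ∈ Fw k γ) : x ∈ J := by
  have h1 := add_ant_mem hζ hχ hJl hJr hn ih hγ hxr hx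
  have h2 := add_ant_mem hζ hχ hJl hJr hn ih hγ (ant_mem_rad χ ζ hχ hxr) (ant_mem_Fw χ hx)
  have h3 : ant χ (ant χ x) = θ • x := by
    refine Fw_induction (P := fun x => ant χ (ant χ x) = θ • x) (fun l hl => ?_) (by simp)
      (fun x y hx hy => ?_) (fun c x hx => ?_) hx
    · rw [ant_ant_mon χ hχ, hθ l hl]
    · rw [map_add, map_add, hx, hy, smul_add]
    · rw [map_smul, map_smul, hx, smul_comm]
  have h4 : (1 - θ) • x ∈ J := by
    have := sub_mem h1 h2
    rw [h3] at this
    convert this using 1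
    rw [sub_smul, one_smul]; abel
  exact (Submodule.smul_mem_iff _ (sub_ne_zero.mpr hθ1.symm)).mp h4

end AntipodeArgument

end BraidedFree

namespace BraidedFree

section SlTwoArgument

variable {k : Type} [Field k] (χ : I → I → k) (ζ : I → k)

open FreeAlgebra (ι)

/-- The braided adjoint action of the generator `i`. -/
def ad (i : I) : FreeAlgebra k I →ₗ[k] FreeAlgebra k I :=
  LinearMap.mulLeft k (ι k i) - LinearMap.mulRight k (ι k i) ∘ₗ (kap χ i).toLinearMap

lemma ad_apply (i : I) (y : FreeAlgebra k I) :
    ad χ i y = ι k i * y - kap χ i y * ι k i := rfl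

lemma ad_mul (i : I) (x y : FreeAlgebra k I) :
    ad χ i (x * y) = ad χ i x * y + kap χ i x * ad χ i y := by
  simp only [ad_apply, map_mul]; noncomm_ring

lemma kap_ad (i : I) (y : FreeAlgebra k I) :
    kap χ i (ad χ i y) = χ i i • ad χ i (kap χ i y) := by
  simp [ad_apply, smul_sub]

lemma pr_ad (i : I) {y : FreeAlgebra k I} (hy : pr χ i y = 0) : pr χ i (ad χ i y) = 0 := by
  simp [ad_apply, pr_mul, pr_kap, hy]

lemma pl_ad (i : I) (y : FreeAlgebra k I) :
    pl χ i (ad χ i y) = y - kap χ i (kap χ i y) + χ i i • ad χ i (pl χ i y) := by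
  simp only [ad_apply, map_sub, pl_mul, pl_ι, pl_kap, if_true, one_mul, kap_ι, smul_sub, mul_one,
    smul_mul_assoc]
  abel

lemma kap_ad_pow (i : I) (n : ℕ) (y : FreeAlgebra k I) :
    kap χ i ((ad χ i ^ n) y) = χ i i ^ n • (ad χ i ^ n) (kap χ i y) := by
  induction n generalizing y with
  | zero => simp
  | succ n ih =>
    rw [pow_succ, Module.End.mul_apply, ih, kap_ad, map_smul, smul_smul, Module.End.mul_apply,
      ← pow_succ]

lemma pl_ad_pow (i : I) {e : k} {x : FreeAlgebra k I} (hx : kap χ i x = e • x) (n : ℕ) :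
    (1 - χ i i) • pl χ i ((ad χ i ^ (n + 1)) x) =
      ((1 - χ i i ^ (n + 1)) * (1 - e ^ 2 * χ i i ^ n)) • (ad χ i ^ n) x +
        ((1 - χ i i) * χ i i ^ (n + 1)) • (ad χ i ^ (n + 1)) (pl χ i x) := by
  have hk : ∀ m, kap χ i ((ad χ i ^ m) x) = (χ i i ^ m * e) • (ad χ i ^ m) x := by
    intro m; rw [kap_ad_pow, hx, map_smul, smul_smul]
  induction n with
  | zero =>
    rw [zero_add, pow_one, pl_ad, hx, map_smul, hx]
    simp only [pow_zero, Module.End.one_apply, pow_one]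
    module
  | succ n ih =>
    rw [pow_succ' (ad χ i) (n + 1), Module.End.mul_apply, pl_ad, hk, map_smul, hk, smul_add,
      smul_comm (1 - χ i i) (χ i i), ← map_smul (ad χ i), ih, map_add, map_smul, map_smul,
      ← Module.End.mul_apply, ← pow_succ' (ad χ i), Module.End.mul_apply]
    module

/-- Two-sided ideals of the free algebra stable under the twists and the skew derivations. -/
structure IsBraidedIdeal (J : Submodule k (FreeAlgebra k I)) : Prop where
  mul_left : ∀ x y, y ∈ J → x * y ∈ J
  mul_right : ∀ x y, x ∈ J → x * y ∈ J
  kap : ∀ i x, x ∈ J → kap χ i x ∈ J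
  pr : ∀ i x, x ∈ J → pr χ i x ∈ J
  pl : ∀ i x, x ∈ J → pl χ i x ∈ J

variable {χ ζ} {J : Submodule k (FreeAlgebra k I)} (hJ : IsBraidedIdeal χ J)

include hJ

lemma ad_pow_mem (i : I) (n : ℕ) {x : FreeAlgebra k I} (hx : x ∈ J) : (ad χ i ^ n) x ∈ J := by
  induction n with
  | zero => simpa using hx
  | succ n ih =>
    rw [pow_succ', Module.End.mul_apply, ad_apply]
    exact sub_mem (hJ.mul_left _ _ ih) (hJ.mul_right _ _ (hJ.kap _ _ ih))

lemma ad_pow_mem_of_le (i : I) {m n : ℕ} (h : m ≤ n) {x : FreeAlgebra k I}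
    (hx : (ad χ i ^ m) x ∈ J) : (ad χ i ^ n) x ∈ J := by
  obtain ⟨r, rfl⟩ := Nat.exists_eq_add_of_le h
  rw [add_comm, pow_add, Module.End.mul_apply]
  exact ad_pow_mem hJ i r hx

lemma ad_pow_kap_mem {i : I} (hQ : χ i i ≠ 0) (n : ℕ) {x : FreeAlgebra k I}
    (hx : (ad χ i ^ n) x ∈ J) : (ad χ i ^ n) (kap χ i x) ∈ J := by
  have := hJ.kap i _ hx
  rw [kap_ad_pow] at this
  exact (Submodule.smul_mem_iff _ (pow_ne_zero _ hQ)).mp this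

lemma ad_pow_mul_mem {i : I} (hQ : χ i i ≠ 0) (n : ℕ) {a b : ℕ} (h : a + b ≤ n)
    {x y : FreeAlgebra k I} (hx : (ad χ i ^ a) x ∈ J) (hy : (ad χ i ^ b) y ∈ J) :
    (ad χ i ^ n) (x * y) ∈ J := by
  induction n generalizing a b x y with
  | zero =>
    obtain rfl : a = 0 := by omega
    simpa using hJ.mul_right _ y hx
  | succ n ih =>
    cases a with
    | zero => exact ad_pow_mem hJ i _ (hJ.mul_right _ y (by simpa using hx))
    | succ a =>
      cases b with
      | zero => exact ad_pow_mem hJ i _ (hJ.mul_left x _ (by simpa using hy))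
      | succ b =>
        rw [pow_succ, Module.End.mul_apply, ad_mul, map_add]
        refine add_mem (ih (a := a) (b := b + 1) (by omega) ?_ hy)
          (ih (a := a + 1) (b := b) (by omega) (ad_pow_kap_mem hJ hQ _ hx) ?_)
        · rwa [pow_succ, Module.End.mul_apply] at hx
        · rwa [pow_succ, Module.End.mul_apply] at hy

omit hJ in
/-- The elements killed by `pr i` on which `ad i` is nilpotent modulo `J`. -/
def nilp (hJ : IsBraidedIdeal χ J) (i : I) : Submodule k (FreeAlgebra k I) where
  carrier := {y | pr χ i y = 0 ∧ ∃ n, (ad χ i ^ n) y ∈ J}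
  add_mem' := by
    rintro x y ⟨hx, m, hm⟩ ⟨hy, n, hn⟩
    refine ⟨by rw [map_add, hx, hy, add_zero], max m n, ?_⟩
    rw [map_add]
    exact add_mem (ad_pow_mem_of_le hJ i (le_max_left _ _) hm)
      (ad_pow_mem_of_le hJ i (le_max_right _ _) hn)
  zero_mem' := ⟨map_zero _, 0, by simp⟩
  smul_mem' := by
    rintro c x ⟨hx, m, hm⟩
    exact ⟨by rw [map_smul, hx, smul_zero], m, by rw [map_smul]; exact J.smul_mem _ hm⟩

omit hJ in
lemma mem_nilp {hJ : IsBraidedIdeal χ J} {i : I} {y : FreeAlgebra k I} :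
    y ∈ nilp hJ i ↔ pr χ i y = 0 ∧ ∃ n, (ad χ i ^ n) y ∈ J := Iff.rfl

lemma exists_eq_sum_nilp {i : I} (hQ : χ i i ≠ 0)
    (hs : ∀ j, i ≠ j → ∃ n, (ad χ i ^ n) (ι k j) ∈ J) (x : FreeAlgebra k I) :
    ∃ (n : ℕ) (Y : ℕ → FreeAlgebra k I), (∀ m, Y m ∈ nilp hJ i) ∧
      x = ∑ m ∈ Finset.range n, Y m * ι k i ^ m := by
  have hone : (1 : FreeAlgebra k I) ∈ nilp hJ i := by
    refine mem_nilp.mpr ⟨pr_one χ i, 1, ?_⟩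
    simp [ad_apply]
  suffices h : x ∈ Submodule.span k
      {z | ∃ y ∈ nilp hJ i, ∃ m : ℕ, z = y * ι k i ^ m} by
    induction h using Submodule.span_induction with
    | mem z hz =>
      obtain ⟨y, hy, m, rfl⟩ := hz
      refine ⟨m + 1, fun l => if l = m then y else 0, fun l => ?_, ?_⟩
      · dsimp only; split_ifs
        · exact hy
        · exact zero_mem _
      · simp
    | zero => exact ⟨0, fun _ => 0, fun _ => zero_mem _, by simp⟩
    | add x y _ _ hx hy =>
      obtain ⟨n, Y, hY, rfl⟩ := hx
      obtain ⟨n', Y', hY', rfl⟩ := hy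
      refine ⟨max n n', fun l => (if l < n then Y l else 0) + (if l < n' then Y' l else 0),
        fun l => ?_, ?_⟩
      · refine add_mem ?_ ?_ <;> split_ifs
        exacts [hY l, zero_mem _, hY' l, zero_mem _]
      · simp only [add_mul, Finset.sum_add_distrib, ite_mul, zero_mul, ← Finset.sum_filter]
        congr 2 <;> (ext l; simp; omega)
    | smul c x _ hx =>
      obtain ⟨n, Y, hY, rfl⟩ := hx
      exact ⟨n, fun l => c • Y l, fun l => Submodule.smul_mem _ _ (hY l), by
        simp [Finset.smul_sum]⟩
  induction x using word_induction with
  | h1 => exact Submodule.subset_span ⟨1, hone, 0, by simp⟩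
  | hadd a b ha hb => exact add_mem ha hb
  | hsmul c a ha => exact Submodule.smul_mem _ _ ha
  | hmul j a ha =>
    induction ha using Submodule.span_induction with
    | zero => simp
    | add x y _ _ hx hy => rw [mul_add]; exact add_mem hx hy
    | smul c x _ hx => rw [mul_smul_comm]; exact Submodule.smul_mem _ _ hx
    | mem z hz =>
      obtain ⟨y, hy, m, rfl⟩ := hz
      obtain ⟨hy0, n, hn⟩ := mem_nilp.mp hy
      rcases eq_or_ne i j with rfl | hij
      · have e : ι k i * (y * ι k i ^ m) = ad χ i y * ι k i ^ m + kap χ i y * ι k i ^ (m + 1) := by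
          rw [ad_apply, pow_succ']; noncomm_ring
        rw [e]
        refine add_mem (Submodule.subset_span ⟨_, mem_nilp.mpr ⟨pr_ad χ i hy0, n, ?_⟩, m, rfl⟩)
          (Submodule.subset_span ⟨_, mem_nilp.mpr ⟨?_, n, ad_pow_kap_mem hJ hQ n hn⟩, _, rfl⟩)
        · rw [← Module.End.mul_apply, ← pow_succ]
          exact ad_pow_mem_of_le hJ i (Nat.le_succ n) hn
        · rw [pr_kap, hy0, map_zero, smul_zero]
      · obtain ⟨n', hn'⟩ := hs j hij
        rw [← mul_assoc]
        refine Submodule.subset_span ⟨_, mem_nilp.mpr ⟨?_, n' + n,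
          ad_pow_mul_mem hJ hQ _ le_rfl hn' hn⟩, m, rfl⟩
        rw [pr_mul, hy0, pr_ι, if_neg hij.symm, mul_zero, zero_mul, add_zero]

omit hJ in
lemma exists_pr_ι_pow {i : I} (hQ : ∀ m : ℕ, 0 < m → χ i i ^ m ≠ 1) (m : ℕ) :
    ∃ c : k, c ≠ 0 ∧ pr χ i (ι k i ^ (m + 1)) = c • ι k i ^ m := by
  have h1 : 1 - χ i i ≠ 0 := sub_ne_zero.mpr fun h => hQ 1 one_pos (by rw [pow_one, ← h])
  refine ⟨(1 - χ i i ^ (m + 1)) / (1 - χ i i),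
    div_ne_zero (sub_ne_zero.mpr (hQ _ (Nat.succ_pos m)).symm) h1, ?_⟩
  induction m with
  | zero => simp [h1]
  | succ m ih =>
    rw [pow_succ, pr_mul, ih, pr_ι, if_pos rfl, mul_one, kap_ι, smul_mul_smul_comm, ← pow_succ]
    nth_rewrite 1 [← one_smul k (ι k i ^ (m + 1))]
    rw [← add_smul]
    congr 1
    field_simp
    ring

omit hJ in
lemma pr_iterate_mul_pow {i : I} (hQ : ∀ m : ℕ, 0 < m → χ i i ^ m ≠ 1) {y : FreeAlgebra k I}
    (hy : pr χ i y = 0) (m : ℕ) :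
    (∀ n, m < n → (pr χ i ^ n) (y * ι k i ^ m) = 0) ∧
      ∃ c : k, c ≠ 0 ∧ (pr χ i ^ m) (y * ι k i ^ m) = c • y := by
  induction m with
  | zero =>
    refine ⟨fun n hn => ?_, 1, one_ne_zero, by simp⟩
    obtain ⟨n, rfl⟩ := Nat.exists_eq_succ_of_ne_zero hn.ne'
    rw [Nat.succ_eq_add_one, pow_succ, Module.End.mul_apply, pow_zero, mul_one, hy, map_zero]
  | succ m ih =>
    obtain ⟨c, hc, h⟩ := exists_pr_ι_pow hQ m
    have h' : pr χ i (y * ι k i ^ (m + 1)) = c • (y * ι k i ^ m) := by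
      rw [pr_mul, h, hy, zero_mul, add_zero, mul_smul_comm]
    obtain ⟨ih1, c', hc', ih2⟩ := ih
    refine ⟨fun n hn => ?_, c * c', mul_ne_zero hc hc', ?_⟩
    · obtain ⟨n, rfl⟩ := Nat.exists_eq_succ_of_ne_zero (Nat.ne_of_gt (Nat.zero_lt_of_lt hn))
      rw [Nat.succ_eq_add_one, pow_succ, Module.End.mul_apply, h', map_smul, ih1 n (by omega),
        smul_zero]
    · rw [pow_succ, Module.End.mul_apply, h', map_smul, ih2, smul_smul]

lemma exists_ad_pow_mem {i : I} (hQ0 : χ i i ≠ 0) (hQ : ∀ m : ℕ, 0 < m → χ i i ^ m ≠ 1)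
    (hs : ∀ j, i ≠ j → ∃ n, (ad χ i ^ n) (ι k j) ∈ J) {x : FreeAlgebra k I}
    (hx : pr χ i x ∈ J) : ∃ n, (ad χ i ^ n) x ∈ J := by
  obtain ⟨n, Y, hY, rfl⟩ := exists_eq_sum_nilp hJ hQ0 hs x
  have hprn : ∀ (m : ℕ) x, x ∈ J → (pr χ i ^ m) x ∈ J := by
    intro m x hx
    induction m with
    | zero => simpa using hx
    | succ m ih => rw [pow_succ', Module.End.mul_apply]; exact hJ.pr _ _ ih
  induction n with
  | zero => exact ⟨0, by simp⟩
  | succ n ih =>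
    rcases Nat.eq_zero_or_pos n with rfl | hn
    · simpa using (mem_nilp.mp (hY 0)).2
    · have hpn : (pr χ i ^ n) (∑ m ∈ Finset.range (n + 1), Y m * ι k i ^ m) ∈ J := by
        obtain ⟨n', rfl⟩ := Nat.exists_eq_succ_of_ne_zero hn.ne'
        rw [Nat.succ_eq_add_one, pow_succ, Module.End.mul_apply]
        exact hprn _ _ hx
      obtain ⟨c, hc, h⟩ := (pr_iterate_mul_pow hQ (mem_nilp.mp (hY n)).1 n).2
      rw [Finset.sum_range_succ, map_add, map_sum, Finset.sum_eq_zero fun m hm =>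
        (pr_iterate_mul_pow hQ (mem_nilp.mp (hY m)).1 m).1 n (Finset.mem_range.mp hm),
        zero_add, h, Submodule.smul_mem_iff _ hc] at hpn
      have hlast := hJ.mul_right _ (ι k i ^ n) hpn
      rw [Finset.sum_range_succ, map_add] at hx
      obtain ⟨N, hN⟩ := ih ((Submodule.add_mem_iff_left _ (hJ.pr i _ hlast)).mp hx)
      refine ⟨N, ?_⟩
      rw [Finset.sum_range_succ, map_add]
      exact add_mem hN (ad_pow_mem hJ i N hlast)

lemma mem_of_pr_pl_mem {i : I} (hQ0 : χ i i ≠ 0) (hQ : ∀ m : ℕ, 0 < m → χ i i ^ m ≠ 1)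
    (hs : ∀ j, i ≠ j → ∃ n, (ad χ i ^ n) (ι k j) ∈ J) {x : FreeAlgebra k I} {e : k}
    (hxe : kap χ i x = e • x) (he : ∀ m : ℕ, e ^ 2 * χ i i ^ m ≠ 1)
    (hx : pr χ i x ∈ J) (hx' : pl χ i x ∈ J) : x ∈ J := by
  obtain ⟨n, hn⟩ := exists_ad_pow_mem hJ hQ0 hQ hs hx
  induction n with
  | zero => simpa using hn
  | succ n ih =>
    refine ih ?_
    have h := pl_ad_pow χ i hxe n
    have h1 := J.smul_mem (1 - χ i i) (hJ.pl i _ hn)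
    rw [h, Submodule.add_mem_iff_left _ (J.smul_mem _ (ad_pow_mem hJ i _ hx')),
      Submodule.smul_mem_iff] at h1
    · exact h1
    · exact mul_ne_zero (sub_ne_zero.mpr (hQ _ (Nat.succ_pos n)).symm)
        (sub_ne_zero.mpr (he n).symm)

/-- The radical is contained in every braided ideal modulo which the adjoint actions are
locally nilpotent on the generators. -/
theorem rad_le (hζ : ∀ i, ζ i ≠ 0) (hχ : ∀ i j, χ i j = χ j i) (hQ0 : ∀ i, χ i i ≠ 0)
    (hQ : ∀ i, ∀ m : ℕ, 0 < m → χ i i ^ m ≠ 1)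
    (hs : ∀ i j, i ≠ j → ∃ n, (ad χ i ^ n) (ι k j) ∈ J)
    (hwt : ∀ γ : I →₀ ℤ, (∃ l, l ≠ [] ∧ wtw l = γ) →
      (∃ θ : k, θ ≠ 1 ∧ ∀ l, wtw l = γ → twist χ l = θ) ∨
      ∃ (i : I) (e : k), (∀ l, wtw l = γ → (l.map (χ i)).prod = e) ∧
        ∀ m : ℕ, e ^ 2 * χ i i ^ m ≠ 1) :
    rad χ ζ ≤ J := by
  have main : ∀ n : ℕ, ∀ γ : I →₀ ℤ, ht γ < n → rad χ ζ ⊓ Fw k γ ≤ J := by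
    intro n
    induction n with
    | zero =>
      intro γ hγ x hx
      obtain ⟨-, hx⟩ := Submodule.mem_inf.mp hx
      refine Fw_induction (P := fun x => x ∈ J) (fun l hl => ?_) (zero_mem _)
        (fun x y hx hy => add_mem hx hy) (fun c x hx => J.smul_mem _ hx) hx
      rw [← hl, ht_wtw] at hγ
      omega
    | succ n ih =>
      intro γ hγ x hx
      obtain ⟨hxr, hx⟩ := Submodule.mem_inf.mp hx
      rcases lt_or_eq_of_le (show ht γ ≤ n by push_cast at hγ; omega) with h | h
      · exact ih γ h (Submodule.mem_inf.mpr ⟨hxr, hx⟩)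
      rcases Nat.eq_zero_or_pos n with rfl | hn
      · have : x = algebraMap k _ (eps k I x) := by
          refine Fw_induction (P := fun x => x = algebraMap k _ (eps k I x))
            (fun l hl => ?_) (by simp) (fun x y hx hy => ?_) (fun c x hx => ?_) hx
          · rw [← hl, ht_wtw] at h
            obtain rfl : l = [] := List.length_eq_zero_iff.mp (by exact_mod_cast h)
            simp
          · rw [map_add, map_add, ← hx, ← hy]
          · rw [map_smul, Algebra.smul_def, smul_eq_mul, map_mul, ← hx]
        rw [this, ← form_one χ ζ, (mem_rad χ ζ).mp hxr, map_zero]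
        exact zero_mem _
      by_cases hl : ∃ l, l ≠ [] ∧ wtw l = γ
      · rcases hwt γ hl with ⟨θ, hθ, hθl⟩ | ⟨i, e, he, he'⟩
        · exact mem_of_twist_ne_one hζ hχ hJ.mul_left hJ.mul_right (by exact_mod_cast hn) ih h
            hθl hθ hxr hx
        · have hlow : ht (γ - Finsupp.single i 1) < n := by rw [ht_sub, ht_single]; omega
          refine mem_of_pr_pl_mem hJ (hQ0 i) (hQ i) (hs i) (e := e) ?_ he'
            (ih _ hlow (Submodule.mem_inf.mpr ⟨pr_mem_rad hζ hxr i, pr_mem_Fw χ i hx⟩))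
            (ih _ hlow (Submodule.mem_inf.mpr ⟨pl_mem_rad hζ hχ hxr i, pl_mem_Fw χ i hx⟩))
          refine Fw_induction (P := fun x => kap χ i x = e • x)
            (fun l hl => ?_) (by simp) (fun x y hx hy => ?_) (fun c x hx => ?_) hx
          · rw [kap_mon, he l hl]
          · rw [map_add, hx, hy, smul_add]
          · rw [map_smul, hx, smul_comm]
      · refine Fw_induction (P := fun x => x ∈ J) (fun l hl' => ?_) (zero_mem _)
          (fun x y hx hy => add_mem hx hy) (fun c x hx => J.smul_mem _ hx) hx
        refine absurd ⟨l, ?_, hl'⟩ hl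
        rintro rfl
        rw [← hl', ht_wtw] at h
        simp at h
        omega
  intro x hx
  rw [← sc_one_apply x]
  exact sc_mem_of_rad _ (fun γ _ => main ((ht γ).toNat + 1) γ (by push_cast; omega)) hx

end SlTwoArgument

end BraidedFree

section Scalars

lemma qh_ne_zero : qh ≠ 0 := pow_ne_zero _ RatFunc.X_ne_zero

lemma qh_pow_ne_one {n : ℕ} (hn : n ≠ 0) : qh ^ n ≠ 1 := by
  intro h
  rw [qh, sqv, ← pow_mul, ← RatFunc.algebraMap_X, ← map_pow,
    ← map_one (algebraMap (Polynomial ℚ) (RatFunc ℚ))] at h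
  have := congrArg Polynomial.natDegree (RatFunc.algebraMap_injective ℚ h)
  simp at this
  exact hn this

lemma qh_zpow_ne_one {n : ℤ} (hn : n ≠ 0) : qh ^ n ≠ 1 := by
  intro h
  rcases Int.natAbs_eq n with h' | h' <;> rw [h'] at h
  · exact qh_pow_ne_one (Int.natAbs_ne_zero.mpr hn) (by exact_mod_cast h)
  · rw [zpow_neg, inv_eq_one] at h
    exact qh_pow_ne_one (Int.natAbs_ne_zero.mpr hn) (by exact_mod_cast h)

lemma qd_ne_zero (A : GCM I) (i : I) : qd A i ≠ 0 := zpow_ne_zero _ qh_ne_zero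

lemma qd_pow_ne_one (A : GCM I) (i : I) {n : ℕ} (hn : n ≠ 0) : qd A i ^ n ≠ 1 := by
  rw [qd, ← zpow_natCast, ← zpow_mul]
  exact qh_zpow_ne_one (mul_ne_zero (A.d_pos i).ne' (by exact_mod_cast hn))

lemma zi_ne_zero (A : GCM I) (i : I) : zi A i ≠ 0 :=
  sub_ne_zero.mpr (qd_pow_ne_one A i two_ne_zero).symm

end Scalars

section QBinomials

variable {t : 𝕂} (ht0 : t ≠ 0) (ht : ∀ n : ℕ, n ≠ 0 → t ^ n ≠ 1)

include ht0 ht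

lemma sub_inv_ne_zero_of_generic {n : ℕ} (hn : n ≠ 0) : t ^ n - t⁻¹ ^ n ≠ 0 := by
  intro h
  rw [sub_eq_zero, inv_pow] at h
  refine ht (n + n) (by omega) ?_
  rw [pow_add]
  nth_rewrite 2 [h]
  exact mul_inv_cancel₀ (pow_ne_zero _ ht0)

lemma qNum_ne_zero {n : ℕ} (hn : n ≠ 0) : qNum t n ≠ 0 :=
  div_ne_zero (sub_inv_ne_zero_of_generic ht0 ht hn)
    (by simpa using sub_inv_ne_zero_of_generic ht0 ht one_ne_zero)

lemma qFact_ne_zero (n : ℕ) : qFact t n ≠ 0 :=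
  Finset.prod_ne_zero_iff.mpr fun _ _ => qNum_ne_zero ht0 ht (Nat.succ_ne_zero _)

omit ht0 ht in
lemma qFact_succ (n : ℕ) : qFact t (n + 1) = qFact t n * qNum t (n + 1) :=
  Finset.prod_range_succ _ _

omit ht0 ht in
lemma qFact_zero : qFact t 0 = 1 := Finset.prod_range_zero _

lemma qBinom_zero_right (n : ℕ) : qBinom t n 0 = 1 := by
  rw [qBinom, qFact_zero, one_mul, Nat.sub_zero, div_self (qFact_ne_zero ht0 ht n)]

lemma qBinom_self (n : ℕ) : qBinom t n n = 1 := by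
  rw [qBinom, Nat.sub_self, qFact_zero, mul_one, div_self (qFact_ne_zero ht0 ht n)]

omit ht0 ht in
lemma qBinom_symm {n m : ℕ} (h : m ≤ n) : qBinom t n (n - m) = qBinom t n m := by
  rw [qBinom, qBinom, Nat.sub_sub_self h, mul_comm]

omit ht in
lemma qNum_add (a b : ℕ) : qNum t (a + b) = t⁻¹ ^ b * qNum t a + t ^ a * qNum t b := by
  rw [qNum, qNum, qNum, mul_div_assoc', mul_div_assoc', ← add_div]
  congr 1
  have := inv_mul_cancel₀ ht0
  have h2 : t⁻¹ ^ b * t ^ b = 1 := by rw [← mul_pow, this, one_pow]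
  rw [pow_add, pow_add]
  linear_combination (0 : 𝕂) * h2

lemma qBinom_succ_succ {n m : ℕ} (h : m + 1 ≤ n) : qBinom t (n + 1) (m + 1) =
    t⁻¹ ^ (m + 1) * qBinom t n (m + 1) + t ^ (n - m) * qBinom t n m := by
  obtain ⟨r, rfl⟩ := Nat.exists_eq_add_of_le h
  rw [qBinom, qBinom, qBinom, show m + 1 + r + 1 - (m + 1) = r + 1 by omega,
    show m + 1 + r - (m + 1) = r by omega, show m + 1 + r - m = r + 1 by omega,
    qFact_succ (m + 1 + r), show m + 1 + r + 1 = (r + 1) + (m + 1) by omega, qNum_add ht0,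
    qFact_succ r, qFact_succ m]
  have h1 := qFact_ne_zero ht0 ht m
  have h2 := qFact_ne_zero ht0 ht r
  have h3 := qNum_ne_zero ht0 ht (Nat.succ_ne_zero m)
  have h4 := qNum_ne_zero ht0 ht (Nat.succ_ne_zero r)
  rw [Nat.succ_eq_add_one] at h3 h4
  have h5 := pow_ne_zero (m + 1) (inv_ne_zero ht0)
  generalize t⁻¹ ^ (m + 1) = s at *
  field_simp

end QBinomials

namespace BraidedFree

open FreeAlgebra (ι)

/-- The coefficients of `ad i ^ n (ι j)` when `χ i i = t²` and `χ i j = t^c`. -/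
def adCoeff (t : 𝕂) (c : ℤ) (n m : ℕ) : 𝕂 :=
  if m ≤ n then (-1) ^ m * qBinom t n m * t ^ (m * ((n : ℤ) + c - 1)) else 0

lemma adCoeff_succ_succ {t : 𝕂} (ht0 : t ≠ 0) (ht : ∀ n : ℕ, n ≠ 0 → t ^ n ≠ 1) (c : ℤ)
    {n m : ℕ} (h : m ≤ n) : adCoeff t c (n + 1) (m + 1) =
      adCoeff t c n (m + 1) - t ^ (2 * (n : ℤ) + c) * adCoeff t c n m := by
  rw [adCoeff, adCoeff, adCoeff, if_pos (by omega), if_pos h]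
  rcases Nat.lt_or_ge m n with h' | h'
  · rw [if_pos (by omega), qBinom_succ_succ ht0 ht (by omega)]
    have e1 : t ^ (((m + 1 : ℕ) : ℤ) * (((n + 1 : ℕ) : ℤ) + c - 1)) =
        t ^ (m + 1) * t ^ (((m + 1 : ℕ) : ℤ) * ((n : ℤ) + c - 1)) := by
      rw [← zpow_natCast, ← zpow_add₀ ht0]; congr 1; push_cast; ring
    have e2 : t ^ (2 * (n : ℤ) + c) * t ^ ((m : ℤ) * ((n : ℤ) + c - 1)) =
        t ^ (n - m) * t ^ (((m + 1 : ℕ) : ℤ) * (((n + 1 : ℕ) : ℤ) + c - 1)) := by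
      rw [← zpow_natCast, ← zpow_add₀ ht0, ← zpow_add₀ ht0, Nat.cast_sub h]
      congr 1; push_cast; ring
    have e3 : t⁻¹ ^ (m + 1) * t ^ (m + 1) = 1 := by
      rw [← mul_pow, inv_mul_cancel₀ ht0, one_pow]
    rw [pow_succ (-1 : 𝕂) m]
    linear_combination ((-1) ^ m * qBinom t n m) * e2 -
      ((-1) ^ m * t⁻¹ ^ (m + 1) * qBinom t n (m + 1)) * e1 -
      ((-1) ^ m * qBinom t n (m + 1) * t ^ (((m + 1 : ℕ) : ℤ) * ((n : ℤ) + c - 1))) * e3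
  · obtain rfl : m = n := le_antisymm h h'
    rw [if_neg (by omega), qBinom_self ht0 ht, qBinom_self ht0 ht]
    have e2 : t ^ (2 * (m : ℤ) + c) * t ^ ((m : ℤ) * ((m : ℤ) + c - 1)) =
        t ^ (((m + 1 : ℕ) : ℤ) * (((m + 1 : ℕ) : ℤ) + c - 1)) := by
      rw [← zpow_add₀ ht0]
      congr 1; push_cast; ring
    rw [pow_succ (-1 : 𝕂) m]
    linear_combination ((-1) ^ m) * e2

lemma ad_pow_ι {χ : I → I → 𝕂} {i j : I} {t : 𝕂} (ht0 : t ≠ 0)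
    (ht : ∀ n : ℕ, n ≠ 0 → t ^ n ≠ 1) {c : ℤ} (hii : χ i i = t ^ (2 : ℤ)) (hij : χ i j = t ^ c)
    (n : ℕ) : (ad χ i ^ n) (ι 𝕂 j) = ∑ m ∈ Finset.range (n + 1),
      adCoeff t c n m • (ι 𝕂 i ^ (n - m) * ι 𝕂 j * ι 𝕂 i ^ m) := by
  induction n with
  | zero => simp [adCoeff, qBinom_zero_right ht0 ht]
  | succ n ih =>
    have hk : ∀ m ≤ n, kap χ i (ι 𝕂 i ^ (n - m) * ι 𝕂 j * ι 𝕂 i ^ m) =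
        t ^ (2 * (n : ℤ) + c) • (ι 𝕂 i ^ (n - m) * ι 𝕂 j * ι 𝕂 i ^ m) := by
      intro m hm
      rw [map_mul, map_mul, map_pow, map_pow, kap_ι, kap_ι, hii, hij, smul_pow, smul_pow,
        smul_mul_smul_comm, smul_mul_smul_comm]
      congr 1
      rw [← zpow_natCast, ← zpow_natCast, ← zpow_mul, ← zpow_mul, ← zpow_add₀ ht0,
        ← zpow_add₀ ht0, Nat.cast_sub hm]
      congr 1; ring
    have h1 : ∑ m ∈ Finset.range (n + 1), adCoeff t c n m •
          (ι 𝕂 i ^ (n + 1 - m) * ι 𝕂 j * ι 𝕂 i ^ m) =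
        ∑ m ∈ Finset.range (n + 1), adCoeff t c n (m + 1) •
          (ι 𝕂 i ^ (n - m) * ι 𝕂 j * ι 𝕂 i ^ (m + 1)) + ι 𝕂 i ^ (n + 1) * ι 𝕂 j := by
      have : adCoeff t c n (n + 1) = 0 := if_neg (by omega)
      rw [Finset.sum_range_succ', Finset.sum_range_succ (fun m => adCoeff t c n (m + 1) •
        (ι 𝕂 i ^ (n - m) * ι 𝕂 j * ι 𝕂 i ^ (m + 1))), this, zero_smul, add_zero]
      simp [adCoeff, qBinom_zero_right ht0 ht]
    have h2 : (ad χ i ^ (n + 1)) (ι 𝕂 j) = ∑ m ∈ Finset.range (n + 1), adCoeff t c n m •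
          (ι 𝕂 i ^ (n + 1 - m) * ι 𝕂 j * ι 𝕂 i ^ m) -
        ∑ m ∈ Finset.range (n + 1), (t ^ (2 * (n : ℤ) + c) * adCoeff t c n m) •
          (ι 𝕂 i ^ (n - m) * ι 𝕂 j * ι 𝕂 i ^ (m + 1)) := by
      rw [pow_succ', Module.End.mul_apply, ih, map_sum, ← Finset.sum_sub_distrib]
      refine Finset.sum_congr rfl fun m hm => ?_
      have hm' : m ≤ n := Nat.lt_succ_iff.mp (Finset.mem_range.mp hm)
      rw [map_smul, ad_apply, hk m hm', smul_sub, Nat.sub_add_comm hm', pow_succ', pow_succ,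
        smul_mul_assoc, smul_smul, mul_comm (adCoeff t c n m)]
      simp only [mul_assoc]
    rw [h2, h1, Finset.sum_range_succ' _ (n + 1), add_sub_right_comm, ← Finset.sum_sub_distrib]
    congr 1
    · refine Finset.sum_congr rfl fun m hm => ?_
      rw [adCoeff_succ_succ ht0 ht c (Nat.lt_succ_iff.mp (Finset.mem_range.mp hm)), sub_smul,
        Nat.succ_sub_succ]
    · simp [adCoeff, qBinom_zero_right ht0 ht]

end BraidedFree

namespace Boson

open BraidedFree
open FreeAlgebra (ι)

section RootLattice

variable (A : GCM I)

lemma ip_add_left (β β' γ : I →₀ ℤ) : ip A (β + β') γ = ip A β γ + ip A β' γ := by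
  refine Finsupp.sum_add_index' (fun i => ?_) fun i a b => ?_
  · simp
  · rw [← Finsupp.sum_add]; congr; ext j c; ring

lemma ip_add_right (β γ γ' : I →₀ ℤ) : ip A β (γ + γ') = ip A β γ + ip A β γ' := by
  rw [ip, ip, ip, ← Finsupp.sum_add]
  congr; ext i a
  exact Finsupp.sum_add_index' (fun j => by ring) fun j b c => by ring

@[simp] lemma ip_zero_left (γ : I →₀ ℤ) : ip A 0 γ = 0 := Finsupp.sum_zero_index

@[simp] lemma ip_zero_right (γ : I →₀ ℤ) : ip A γ 0 = 0 := by simp [ip]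

lemma ip_single_single (i j : I) (a b : ℤ) :
    ip A (Finsupp.single i a) (Finsupp.single j b) = a * b * (A.d i * A.c i j) := by
  simp [ip]

lemma ip_symm (β γ : I →₀ ℤ) : ip A β γ = ip A γ β := by
  rw [ip, ip, Finsupp.sum_comm]
  congr; ext i a; congr; ext j b
  rw [A.dsymm i j]; ring

/-- The braiding matrix `χ i j = q^{(α_i, α_j)}`. -/
def brd (i j : I) : 𝕂 := qh ^ (A.d i * A.c i j)

lemma brd_symm (i j : I) : brd A i j = brd A j i := by rw [brd, brd, A.dsymm]

lemma prod_brd (i : I) (l : List I) :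
    (l.map (brd A i)).prod = qh ^ ip A (Finsupp.single i 1) (wtw l) := by
  induction l with
  | nil => simp
  | cons j l ih =>
    rw [List.map_cons, List.prod_cons, ih, wtw_cons, ip_add_right, zpow_add₀ qh_ne_zero,
      ip_single_single, brd]
    simp

lemma kap_eq_sc (i : I) (x : FreeAlgebra 𝕂 I) :
    kap (brd A) i x = sc (fun γ => qh ^ ip A (Finsupp.single i 1) γ) x := by
  have : (kap (brd A) i).toLinearMap = sc (fun γ => qh ^ ip A (Finsupp.single i 1) γ) :=
    linearMap_ext fun l => by rw [AlgHom.toLinearMap_apply, kap_mon, sc_mon, prod_brd]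
  exact DFunLike.congr_fun this x

lemma twist_brd (l : List I) : twist (brd A) l =
    qh ^ (ip A (wtw l) (wtw l) - (wtw l).sum fun i a => a * (A.d i * A.c i i)) := by
  induction l with
  | nil => simp [twist]
  | cons j l ih =>
    rw [twist, ih, prod_brd, ← zpow_natCast, ← zpow_mul, ← zpow_add₀ qh_ne_zero, wtw_cons]
    congr 1
    rw [Finsupp.sum_add_index' (fun i => by ring) fun i a b => by ring,
      Finsupp.sum_single_index (by ring), ip_add_left, ip_add_right, ip_add_right,
      ip_single_single, ip_symm A (wtw l) (Finsupp.single j 1)]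
    push_cast; ring

lemma brd_weight_cases (l : List I) (hl : l ≠ []) :
    (∃ θ : 𝕂, θ ≠ 1 ∧ ∀ l', wtw l' = wtw l → twist (brd A) l' = θ) ∨
      ∃ (i : I) (e : 𝕂), (∀ l', wtw l' = wtw l → (l'.map (brd A i)).prod = e) ∧
        ∀ m : ℕ, e ^ 2 * brd A i i ^ m ≠ 1 := by
  have hdii : ∀ i, 0 < A.d i * A.c i i := fun i => by
    rw [A.diag]; exact mul_pos (A.d_pos i) two_pos
  by_cases h : ∃ i, 0 < ip A (Finsupp.single i 1) (wtw l)
  · obtain ⟨i, hi⟩ := h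
    refine Or.inr ⟨i, _, fun l' hl' => by rw [prod_brd, hl'], fun m => ?_⟩
    rw [brd, ← zpow_natCast, ← zpow_natCast, ← zpow_mul, ← zpow_mul, ← zpow_add₀ qh_ne_zero]
    refine qh_zpow_ne_one (ne_of_gt ?_)
    have := hdii i
    push_cast; positivity
  · push Not at h
    refine Or.inl ⟨_, ?_, fun l' hl' => by rw [twist_brd, hl']⟩
    have h1 : ∀ l' : List I, ip A (wtw l') (wtw l) ≤ 0 := by
      intro l'
      induction l' with
      | nil => simp
      | cons j l' ih => rw [wtw_cons, ip_add_left]; linarith [h j]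
    have h2 : ∀ l' : List I, 0 ≤ (wtw l').sum fun i a => a * (A.d i * A.c i i) := by
      intro l'
      induction l' with
      | nil => simp
      | cons j l' ih =>
        rw [wtw_cons, Finsupp.sum_add_index' (fun i => by ring) fun i a b => by ring,
          Finsupp.sum_single_index (by ring)]
        linarith [hdii j]
    obtain ⟨j, l', rfl⟩ := List.exists_cons_of_ne_nil hl
    refine qh_zpow_ne_one (ne_of_lt ?_)
    have h3 := h1 (j :: l')
    rw [wtw_cons, Finsupp.sum_add_index' (fun i => by ring) fun i a b => by ring,
      Finsupp.sum_single_index (by ring), ← wtw_cons]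
    linarith [hdii j, h2 l']

end RootLattice

section Relations

variable (A : GCM I)

lemma ff_mul_ff (i j : I) {m p : ℤ} (h : m < p) : ff A i m * ff A j p =
    qh ^ (((p - m + 1).negOnePow : ℤ) * (A.d i * A.c i j)) • (ff A j p * ff A i m) +
      if j = i ∧ p = m + 1 then zi A i • 1 else 0 := by
  have := RingQuot.mkAlgHom_rel 𝕂 (hARel.comm (A := A) i j m p h)
  rw [map_mul, map_add, map_smul, map_mul] at this
  rw [ff, ff, this]
  congr 1
  split_ifs
  · rw [map_smul, map_one, zi]
  · rw [map_zero]

lemma ff_mul_ff_succ (i j : I) (p : ℤ) : ff A i p * ff A j (p + 1) =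
    brd A i j • (ff A j (p + 1) * ff A i p) + if j = i then zi A i • 1 else 0 := by
  rw [ff_mul_ff A i j (lt_add_one p), show p + 1 - p + 1 = 2 by ring, Int.negOnePow_even 2 even_two]
  simp [brd]

lemma map_serreIn {R S : Type} [Ring R] [Algebra 𝕂 R] [Ring S] [Algebra 𝕂 S] (f : R →ₐ[𝕂] S)
    (i j : I) (a b : R) : f (serreIn A i j a b) = serreIn A i j (f a) (f b) := by
  simp [serreIn]

lemma serreIn_ff {i j : I} (h : i ≠ j) (p : ℤ) : serreIn A i j (ff A i p) (ff A j p) = 0 := by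
  have := RingQuot.mkAlgHom_rel 𝕂 (hARel.serre (A := A) i j p h)
  rwa [map_serreIn, map_zero] at this

/-- The homomorphism from the free algebra onto the subalgebra `Â[p]`. -/
def phi (p : ℤ) : FreeAlgebra 𝕂 I →ₐ[𝕂] hA A := FreeAlgebra.lift 𝕂 fun i => ff A i p

@[simp] lemma phi_ι (p : ℤ) (i : I) : phi A p (ι 𝕂 i) = ff A i p := by simp [phi]

lemma phi_mul_ff (p : ℤ) (i : I) (y : FreeAlgebra 𝕂 I) : phi A p y * ff A i (p + 1) =
    ff A i (p + 1) * phi A p (kap (brd A) i y) + zi A i • phi A p (pr (brd A) i y) := by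
  induction y using word_induction with
  | h1 => simp
  | hadd a b ha hb => simp only [add_mul, map_add, ha, hb, mul_add, smul_add]; abel
  | hsmul c a ha => simp only [map_smul, smul_mul_assoc, ha, mul_smul_comm, smul_add,
      smul_comm c (zi A i)]
  | hmul j a ha =>
    rw [map_mul, mul_assoc, ha, mul_add, ← mul_assoc, phi_ι, ff_mul_ff_succ, pr_ι_mul, map_mul,
      map_mul, kap_ι, map_add, map_mul, map_smul, phi_ι, brd_symm A j i]
    by_cases h : i = j
    · subst h; simp [add_mul, mul_assoc]; abel
    · simp [h, Ne.symm h, mul_assoc]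

lemma ff_mul_phi (p : ℤ) (i : I) (y : FreeAlgebra 𝕂 I) : ff A i p * phi A (p + 1) y =
    phi A (p + 1) (kap (brd A) i y) * ff A i p + zi A i • phi A (p + 1) (pl (brd A) i y) := by
  induction y using word_induction with
  | h1 => simp
  | hadd a b ha hb => simp only [add_mul, map_add, ha, hb, mul_add, smul_add]; abel
  | hsmul c a ha => simp only [map_smul, smul_mul_assoc, ha, mul_smul_comm, smul_add,
      smul_comm c (zi A i)]
  | hmul j a ha =>
    rw [map_mul, ← mul_assoc, phi_ι, ff_mul_ff_succ, pl_ι_mul, map_mul, kap_ι, map_add, map_mul,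
      map_smul, phi_ι]
    by_cases h : j = i
    · subst h; simp [add_mul, mul_assoc, ha, mul_add, smul_smul, mul_comm]; abel
    · simp [h, mul_assoc, ha, mul_add, smul_smul, mul_comm]

end Relations

section Grading

variable (A : GCM I)

/-- The sign `(-1)^{p+1}` of the weights of `Â[p]`. -/
def sg (p : ℤ) : ℤ := ((p + 1).negOnePow : ℤ)

lemma sg_mul_self (p : ℤ) : sg p * sg p = 1 := by
  rw [sg, ← Units.val_mul, ← Int.negOnePow_add, Int.negOnePow_even _ (by simp), Units.val_one]

lemma sg_succ (p : ℤ) : sg (p + 1) = -sg p := by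
  rw [sg, sg, Int.negOnePow_succ, Units.val_neg]

/-- The coaction of the root lattice recording the weights. -/
def coact : hA A →ₐ[𝕂] AddMonoidAlgebra (hA A) (I →₀ ℤ) :=
  RingQuot.liftAlgHom 𝕂 ⟨FreeAlgebra.lift 𝕂 fun a : I × ℤ =>
    AddMonoidAlgebra.single (Finsupp.single a.1 (sg a.2)) (ff A a.1 a.2), by
    rintro _ _ (⟨i, j, p, h⟩ | ⟨i, j, m, p, h⟩)
    · refine (map_serreIn A (FreeAlgebra.lift 𝕂 fun a : I × ℤ => AddMonoidAlgebra.single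
        (Finsupp.single a.1 (sg a.2)) (ff A a.1 a.2)) i j _ _).trans ?_
      rw [map_zero, FreeAlgebra.lift_ι_apply, FreeAlgebra.lift_ι_apply]
      set n := (1 - A.c i j).toNat with hn
      have key : serreIn A i j
          (AddMonoidAlgebra.single (Finsupp.single i (sg p)) (ff A i p))
          (AddMonoidAlgebra.single (Finsupp.single j (sg p)) (ff A j p)) =
          AddMonoidAlgebra.single (n • Finsupp.single i (sg p) + Finsupp.single j (sg p))
            (serreIn A i j (ff A i p) (ff A j p)) := by
        rw [serreIn, serreIn, ← hn, ← AddMonoidAlgebra.singleAddHom_apply (n • _ + _), map_sum]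
        refine Finset.sum_congr rfl fun m hm => ?_
        rw [AddMonoidAlgebra.singleAddHom_apply, AddMonoidAlgebra.single_pow,
          AddMonoidAlgebra.single_pow, AddMonoidAlgebra.single_mul_single,
          AddMonoidAlgebra.single_mul_single, AddMonoidAlgebra.smul_single]
        congr 1
        obtain ⟨r, hr⟩ := Nat.exists_eq_add_of_le (Nat.lt_succ_iff.mp (Finset.mem_range.mp hm))
        rw [hr, Nat.add_sub_cancel_left, add_smul]; abel
      rw [key, serreIn_ff A h, AddMonoidAlgebra.single_zero]
    · rw [map_mul, map_add, map_smul, map_mul, FreeAlgebra.lift_ι_apply,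
        FreeAlgebra.lift_ι_apply, AddMonoidAlgebra.single_mul_single,
        AddMonoidAlgebra.single_mul_single, ff_mul_ff A i j h, AddMonoidAlgebra.single_add,
        AddMonoidAlgebra.smul_single, add_comm (Finsupp.single i (sg m))]
      congr 1
      split_ifs with h'
      · obtain ⟨rfl, rfl⟩ := h'
        rw [map_smul, map_one, AddMonoidAlgebra.one_def, AddMonoidAlgebra.smul_single, zi,
          ← Finsupp.single_add, sg_succ, neg_add_cancel, Finsupp.single_zero]
      · rw [map_zero, AddMonoidAlgebra.single_zero]⟩

@[simp] lemma coact_ff (i : I) (p : ℤ) :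
    coact A (ff A i p) = AddMonoidAlgebra.single (Finsupp.single i (sg p)) (ff A i p) := by
  rw [ff, coact, RingQuot.liftAlgHom_mkAlgHom_apply, FreeAlgebra.lift_ι_apply]
  rfl

/-- The operator acting on the weight space of weight `β` of `Â` by the scalar `g β`. -/
def hsc (g : (I →₀ ℤ) → 𝕂) : hA A →ₗ[𝕂] hA A where
  toFun x := (coact A x).coeff.sum fun β a => g β • a
  map_add' x y := by
    rw [map_add, AddMonoidAlgebra.coeff_add]
    exact Finsupp.sum_add_index' (fun β => smul_zero _) fun β a b => smul_add _ _ _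
  map_smul' c x := by
    rw [map_smul, AddMonoidAlgebra.coeff_smul, Finsupp.sum_smul_index' fun β => smul_zero _,
      RingHom.id_apply, Finsupp.smul_sum]
    simp only [smul_comm c]

lemma hsc_prod (g : (I →₀ ℤ) → 𝕂) (l : List (I × ℤ)) :
    hsc A g (l.map fun p => ff A p.1 p.2).prod =
      g (l.map fun p => Finsupp.single p.1 (sg p.2)).sum •
        (l.map fun p => ff A p.1 p.2).prod := by
  have : coact A (l.map fun p => ff A p.1 p.2).prod =
      AddMonoidAlgebra.single (l.map fun p => Finsupp.single p.1 (sg p.2)).sum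
        (l.map fun p => ff A p.1 p.2).prod := by
    induction l with
    | nil => simp [AddMonoidAlgebra.one_def]
    | cons a l ih =>
      rw [List.map_cons, List.prod_cons, map_mul, ih, coact_ff,
        AddMonoidAlgebra.single_mul_single, List.map_cons, List.sum_cons]
  change (coact A _).coeff.sum _ = _
  rw [this, AddMonoidAlgebra.coeff_single]
  exact Finsupp.sum_single_index (smul_zero _)

lemma phi_mon (p : ℤ) (l : List I) : phi A p (mon 𝕂 l) = (l.map fun i => ff A i p).prod := by
  induction l with
  | nil => simp
  | cons i l ih => rw [mon_cons, map_mul, ih, phi_ι, List.map_cons, List.prod_cons]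

lemma hsc_phi (g : (I →₀ ℤ) → 𝕂) (p : ℤ) (x : FreeAlgebra 𝕂 I) :
    hsc A g (phi A p x) = phi A p (sc (fun γ => g (sg p • γ)) x) := by
  have : hsc A g ∘ₗ (phi A p).toLinearMap =
      (phi A p).toLinearMap ∘ₗ sc (fun γ => g (sg p • γ)) := by
    refine linearMap_ext fun l => ?_
    rw [LinearMap.comp_apply, LinearMap.comp_apply, AlgHom.toLinearMap_apply,
      AlgHom.toLinearMap_apply, sc_mon, map_smul, phi_mon]
    have h := hsc_prod A g (l.map fun i => (i, p))
    rw [List.map_map, List.map_map] at h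
    refine h.trans ?_
    congr 2
    clear h
    induction l with
    | nil => simp
    | cons i l ih =>
      rw [List.map_cons, List.sum_cons, ih, wtw_cons, smul_add, Finsupp.smul_single, smul_eq_mul,
        mul_one, Function.comp_apply]
  exact DFunLike.congr_fun this x

lemma hsc_of_mem (g : (I →₀ ℤ) → 𝕂) {β : I →₀ ℤ} {x : hA A} (hx : x ∈ hAwt A β) :
    hsc A g x = g β • x := by
  induction hx using Submodule.span_induction with
  | mem x hx => obtain ⟨l, rfl, rfl⟩ := hx; exact hsc_prod A g l
  | zero => simp
  | add x y _ _ hx hy => rw [map_add, hx, hy, smul_add]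
  | smul c x _ hx => rw [map_smul, hx, smul_comm]

lemma phi_mem_hAwt (p : ℤ) {γ : I →₀ ℤ} {x : FreeAlgebra 𝕂 I} (hx : x ∈ Fw 𝕂 γ) :
    phi A p x ∈ hAwt A (sg p • γ) := by
  refine map_mem_of_mon (phi A p).toLinearMap _ (fun l hl => ?_) hx
  subst hl
  rw [AlgHom.toLinearMap_apply, phi_mon]
  refine Submodule.subset_span ⟨l.map fun i => (i, p), ?_, by rw [List.map_map]; rfl⟩
  clear hx
  induction l with
  | nil => simp
  | cons i l ih =>
    rw [List.map_cons, List.map_cons, List.sum_cons, ih, wtw_cons, smul_add, Finsupp.smul_single,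
      smul_eq_mul, mul_one, sg]

lemma phi_mem_hAk (p : ℤ) (x : FreeAlgebra 𝕂 I) : phi A p x ∈ hAk A p := by
  induction x using word_induction with
  | h1 => rw [map_one]; exact one_mem _
  | hadd a b ha hb => rw [map_add]; exact add_mem ha hb
  | hsmul c a ha => rw [map_smul]; exact Subalgebra.smul_mem _ ha c
  | hmul i a ha =>
    rw [map_mul, phi_ι]
    exact mul_mem (Algebra.subset_adjoin ⟨i, p, le_rfl, le_rfl, rfl⟩) ha

lemma exists_phi_eq {m : ℤ} {β : I →₀ ℤ} {x : hA A} (hx : x ∈ hAk A m) (hx' : x ∈ hAwt A β) :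
    ∃ w ∈ Fw 𝕂 (sg m • β), phi A m w = x := by
  have hle : hAk A m ≤ (phi A m).range := by
    refine Algebra.adjoin_le ?_
    rintro _ ⟨i, p, h1, h2, rfl⟩
    obtain rfl := le_antisymm h1 h2
    exact ⟨ι 𝕂 i, phi_ι A _ i⟩
  obtain ⟨w, rfl⟩ := hle hx
  refine ⟨_, sc_single_mem_Fw (sg m • β) w, ?_⟩
  have h := hsc_of_mem A (Pi.single β 1) hx'
  rw [Pi.single_eq_same, one_smul, AlgHom.toRingHom_eq_coe, RingHom.coe_coe, hsc_phi] at h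
  have hg : (Pi.single (sg m • β) 1 : (I →₀ ℤ) → 𝕂) =
      fun γ => (Pi.single β 1 : (I →₀ ℤ) → 𝕂) (sg m • γ) := by
    funext γ
    by_cases hγ : γ = sg m • β
    · subst hγ
      rw [Pi.single_eq_same, smul_smul, sg_mul_self, one_smul, Pi.single_eq_same]
    · rw [Pi.single_eq_of_ne hγ, Pi.single_eq_of_ne]
      rintro rfl
      rw [smul_smul, sg_mul_self, one_smul] at hγ
      exact hγ rfl
  rw [hg]
  exact h

end Grading

section Radical

variable (A : GCM I)

lemma isBraidedIdeal_ker (p : ℤ) :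
    IsBraidedIdeal (brd A) (LinearMap.ker (phi A p).toLinearMap) := by
  have hk : ∀ i x, phi A p x = 0 → phi A p (kap (brd A) i x) = 0 := by
    intro i x hx
    have := hsc_phi A (fun β => qh ^ ip A (Finsupp.single i 1) (sg p • β)) p x
    rw [hx, map_zero] at this
    rw [kap_eq_sc, this]
    simp only [smul_smul, sg_mul_self, one_smul]
  refine ⟨fun x y hy => ?_, fun x y hx => ?_, fun i x hx => hk i x hx, fun i x hx => ?_,
    fun i x hx => ?_⟩
  · rw [LinearMap.mem_ker, AlgHom.toLinearMap_apply] at hy ⊢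
    rw [map_mul, hy, mul_zero]
  · rw [LinearMap.mem_ker, AlgHom.toLinearMap_apply] at hx ⊢
    rw [map_mul, hx, zero_mul]
  · rw [LinearMap.mem_ker, AlgHom.toLinearMap_apply] at hx ⊢
    have := phi_mul_ff A p i x
    rw [hx, hk i x hx, zero_mul, mul_zero, zero_add] at this
    exact (smul_eq_zero.mp this.symm).resolve_left (zi_ne_zero A i)
  · rw [LinearMap.mem_ker, AlgHom.toLinearMap_apply] at hx ⊢
    have := ff_mul_phi A (p - 1) i x
    rw [sub_add_cancel, hx, hk i x hx, zero_mul, mul_zero, zero_add] at this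
    exact (smul_eq_zero.mp this.symm).resolve_left (zi_ne_zero A i)

lemma phi_ad_pow_ι {i j : I} (h : i ≠ j) (p : ℤ) :
    phi A p ((ad (brd A) i ^ (1 - A.c i j).toNat) (ι 𝕂 j)) = 0 := by
  have hii : brd A i i = qd A i ^ (2 : ℤ) := by rw [brd, A.diag, qd, ← zpow_mul]
  have hij : brd A i j = qd A i ^ A.c i j := by rw [brd, qd, ← zpow_mul]
  have hn : (((1 - A.c i j).toNat : ℕ) : ℤ) = 1 - A.c i j :=
    Int.toNat_of_nonneg (by linarith [A.offdiag i j h])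
  rw [ad_pow_ι (qd_ne_zero A i) (fun n hn => qd_pow_ne_one A i hn) hii hij]
  have hserre := serreIn_ff A h p
  rw [serreIn] at hserre
  set n := (1 - A.c i j).toNat
  rw [← Finset.sum_range_reflect, map_sum]
  have : ∀ m ∈ Finset.range (n + 1),
      phi A p (adCoeff (qd A i) (A.c i j) n (n + 1 - 1 - m) •
        (ι 𝕂 i ^ (n - (n + 1 - 1 - m)) * ι 𝕂 j * ι 𝕂 i ^ (n + 1 - 1 - m))) =
      (-1 : 𝕂) ^ n • (((-1 : 𝕂) ^ m * qBinom (qd A i) n m) •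
        (ff A i p ^ m * ff A j p * ff A i p ^ (n - m))) := by
    intro m hm
    have hm' : m ≤ n := Nat.lt_succ_iff.mp (Finset.mem_range.mp hm)
    rw [Nat.add_sub_cancel, Nat.sub_sub_self hm', map_smul, map_mul, map_mul, map_pow, map_pow,
      phi_ι, phi_ι, smul_smul, adCoeff, if_pos (Nat.sub_le _ _), qBinom_symm hm', hn]
    congr 1
    rw [show 1 - A.c i j + A.c i j - 1 = 0 by ring, mul_zero, zpow_zero, mul_one, ← mul_assoc]
    congr 1
    obtain ⟨r, hr⟩ := Nat.exists_eq_add_of_le hm'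
    rw [hr, Nat.add_sub_cancel_left, ← pow_add, show m + r + m = r + 2 * m by ring, pow_add,
      pow_mul]
    simp
  rw [Finset.sum_congr rfl this, ← Finset.smul_sum, hserre, smul_zero]

/-- The radical of the form on the free algebra is killed in every `Â[p]`. -/
theorem phi_eq_zero_of_mem_rad (p : ℤ) {x : FreeAlgebra 𝕂 I} (hx : x ∈ rad (brd A) (zi A)) :
    phi A p x = 0 := by
  have hQ : ∀ i, ∀ m : ℕ, 0 < m → brd A i i ^ m ≠ 1 := by
    intro i m hm
    rw [brd, ← zpow_natCast, ← zpow_mul, A.diag]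
    have := A.d_pos i
    exact qh_zpow_ne_one (by positivity)
  refine rad_le (isBraidedIdeal_ker A p) (zi_ne_zero A) (brd_symm A)
    (fun i => zpow_ne_zero _ qh_ne_zero) hQ (fun i j h => ⟨_, phi_ad_pow_ι A h p⟩) ?_ hx
  rintro _ ⟨l, hl, rfl⟩
  exact brd_weight_cases A l hl

end Radical

end Boson

namespace Boson

open BraidedFree
open FreeAlgebra (ι)

section Spanning

variable (A : GCM I)

lemma exists_ff_mul_phi (j : I) {k b : ℤ} (h : k < b) (y : FreeAlgebra 𝕂 I) :
    ∃ y' y'' : FreeAlgebra 𝕂 I, ff A j k * phi A b y = phi A b y' * ff A j k + phi A b y'' := by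
  induction y using word_induction with
  | h1 => exact ⟨1, 0, by simp⟩
  | hadd x y hx hy =>
    obtain ⟨x', x'', hx⟩ := hx
    obtain ⟨y', y'', hy⟩ := hy
    refine ⟨x' + y', x'' + y'', ?_⟩
    simp only [map_add, mul_add, hx, hy, add_mul]
    abel
  | hsmul c x hx =>
    obtain ⟨x', x'', hx⟩ := hx
    refine ⟨c • x', c • x'', ?_⟩
    simp only [map_smul, mul_smul_comm, hx, smul_add, smul_mul_assoc]
  | hmul i x hx =>
    obtain ⟨x', x'', hx⟩ := hx
    have hc : ∃ c c' : 𝕂, ff A j k * ff A i b = c • (ff A i b * ff A j k) + c' • 1 := by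
      rw [ff_mul_ff A j i h]
      split_ifs
      · exact ⟨_, _, rfl⟩
      · exact ⟨_, 0, congrArg _ (zero_smul 𝕂 (1 : hA A)).symm⟩
    obtain ⟨c, c', hc⟩ := hc
    refine ⟨c • (ι 𝕂 i * x'), c • (ι 𝕂 i * x'') + c' • x, ?_⟩
    rw [map_mul, phi_ι, ← mul_assoc, hc, add_mul, smul_mul_assoc, mul_assoc, hx]
    simp only [map_smul, map_add, map_mul, phi_ι, mul_add, smul_add, smul_mul_assoc, one_mul,
      mul_assoc, add_assoc]

lemma phi_mul_mem_span (b : ℤ) (S : Set (hA A)) (y : FreeAlgebra 𝕂 I) {v : hA A}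
    (hv : v ∈ S) :
    phi A b y * v ∈ Submodule.span 𝕂 {z | ∃ l : List I, ∃ v ∈ S, z = phi A b (mon 𝕂 l) * v} := by
  induction y using mon_induction with
  | hw l => exact Submodule.subset_span ⟨l, v, hv, rfl⟩
  | h0 => simp
  | hadd x y hx hy => rw [map_add, add_mul]; exact add_mem hx hy
  | hsmul c x hx => rw [map_smul, smul_mul_assoc]; exact Submodule.smul_mem _ _ hx

/-- Elements of level at most `b` are sums of products of an element of level `b` with an
element of level less than `b`. -/
lemma mem_span_of_mem_adjoin (b : ℤ) {S T : Set (hA A)}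
    (hS : ∀ s ∈ S, ∃ i k, k < b ∧ s = ff A i k)
    (hT : ∀ s ∈ T, s ∈ S ∨ ∃ i, s = ff A i b) {x : hA A} (hx : x ∈ Algebra.adjoin 𝕂 T) :
    x ∈ Submodule.span 𝕂 {z | ∃ l : List I, ∃ v ∈ (Algebra.adjoin 𝕂 S : Set (hA A)),
      z = phi A b (mon 𝕂 l) * v} := by
  set P := Submodule.span 𝕂 {z | ∃ l : List I, ∃ v ∈ (Algebra.adjoin 𝕂 S : Set (hA A)),
      z = phi A b (mon 𝕂 l) * v} with hP
  have hphi : ∀ y v, v ∈ Algebra.adjoin 𝕂 S → phi A b y * v ∈ P := fun y v hv =>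
    phi_mul_mem_span A b _ y hv
  suffices H : ∀ z ∈ P, x * z ∈ P by
    have := H 1 (by simpa using hphi 1 1 (one_mem _))
    rwa [mul_one] at this
  induction hx using Algebra.adjoin_induction with
  | mem s hs =>
    intro z hz
    induction hz using Submodule.span_induction with
    | mem z hz =>
      obtain ⟨l, v, hv, rfl⟩ := hz
      rcases hT s hs with h | ⟨i, rfl⟩
      · obtain ⟨i, k, hk, rfl⟩ := hS s h
        obtain ⟨y', y'', hy⟩ := exists_ff_mul_phi A i hk (mon 𝕂 l)
        rw [← mul_assoc, hy, add_mul, mul_assoc]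
        exact add_mem (hphi _ _ (mul_mem (Algebra.subset_adjoin h) hv)) (hphi _ _ hv)
      · rw [← mul_assoc, ← phi_ι, ← map_mul]
        exact hphi _ _ hv
    | zero => rw [mul_zero]; exact zero_mem _
    | add z z' _ _ hz hz' => rw [mul_add]; exact add_mem hz hz'
    | smul c z _ hz => rw [mul_smul_comm]; exact Submodule.smul_mem _ _ hz
  | algebraMap c =>
    intro z hz
    rw [← Algebra.smul_def]
    exact Submodule.smul_mem _ _ hz
  | add x y _ _ hx hy => intro z hz; rw [add_mul]; exact add_mem (hx z hz) (hy z hz)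
  | mul x y _ _ hx hy => intro z hz; rw [mul_assoc]; exact hx _ (hy z hz)

lemma mem_span_of_mem_hAle (b : ℤ) {x : hA A} (hx : x ∈ hAle A b) :
    x ∈ Submodule.span 𝕂 {z | ∃ l : List I, ∃ v ∈ (hAlt A b : Set (hA A)),
      z = phi A b (mon 𝕂 l) * v} := by
  refine mem_span_of_mem_adjoin A b ?_ ?_ hx
  · rintro _ ⟨i, k, hk, rfl⟩
    exact ⟨i, k, by omega, rfl⟩
  · rintro _ ⟨i, k, hk, rfl⟩
    rcases hk.lt_or_eq with h | rfl
    · exact Or.inl ⟨i, k, by omega, rfl⟩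
    · exact Or.inr ⟨i, rfl⟩

lemma mem_span_of_mem_hAband (a b : ℤ) {x : hA A} (hx : x ∈ hAband A a b) :
    x ∈ Submodule.span 𝕂 {z | ∃ l : List I, ∃ v ∈ (hAband A a (b - 1) : Set (hA A)),
      z = phi A b (mon 𝕂 l) * v} := by
  refine mem_span_of_mem_adjoin A b ?_ ?_ hx
  · rintro _ ⟨i, k, _, hk, rfl⟩
    exact ⟨i, k, by omega, rfl⟩
  · rintro _ ⟨i, k, ha, hk, rfl⟩
    rcases hk.lt_or_eq with h | rfl
    · exact Or.inl ⟨i, k, ha, by omega, rfl⟩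
    · exact Or.inr ⟨i, rfl⟩

lemma hAle_mono {a b : ℤ} (h : a ≤ b) : hAle A a ≤ hAle A b :=
  Algebra.adjoin_mono fun _ ⟨i, k, hk, hx⟩ => ⟨i, k, hk.trans h, hx⟩

lemma hAk_le_hAle {k b : ℤ} (h : k ≤ b) : hAk A k ≤ hAle A b :=
  Algebra.adjoin_mono fun _ ⟨i, m, _, hm, hx⟩ => ⟨i, m, hm.trans h, hx⟩

lemma hAband_mono {a b a' b' : ℤ} (ha : a' ≤ a) (hb : b ≤ b') : hAband A a b ≤ hAband A a' b' :=
  Algebra.adjoin_mono fun _ ⟨i, k, h1, h2, hx⟩ => ⟨i, k, ha.trans h1, h2.trans hb, hx⟩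

lemma exists_mem_hAband (x : hA A) : ∃ N : ℕ, x ∈ hAband A (-N) N := by
  obtain ⟨x, rfl⟩ := RingQuot.mkAlgHom_surjective 𝕂 (hARel A) x
  have hle : ∀ {N N' : ℕ}, N ≤ N' → hAband A (-N) N ≤ hAband A (-N') N' := fun h =>
    hAband_mono A (by omega) (by omega)
  induction x using FreeAlgebra.induction with
  | grade0 c => exact ⟨0, by rw [AlgHom.commutes]; exact Subalgebra.algebraMap_mem _ c⟩
  | grade1 a =>
    refine ⟨a.2.natAbs, Algebra.subset_adjoin ⟨a.1, a.2, ?_, ?_, rfl⟩⟩ <;> omega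
  | mul x y hx hy =>
    obtain ⟨N, hN⟩ := hx
    obtain ⟨N', hN'⟩ := hy
    exact ⟨max N N', by
      rw [map_mul]; exact mul_mem (hle (le_max_left _ _) hN) (hle (le_max_right _ _) hN')⟩
  | add x y hx hy =>
    obtain ⟨N, hN⟩ := hx
    obtain ⟨N', hN'⟩ := hy
    exact ⟨max N N', by
      rw [map_add]; exact add_mem (hle (le_max_left _ _) hN) (hle (le_max_right _ _) hN')⟩

end Spanning

section QuasiCentral

variable (A : GCM I)

/-- `u` commutes with the `f_{i,b+1}` up to the powers of `q` prescribed by the weight `μ`. -/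
def QComm (b : ℤ) (μ : I →₀ ℤ) (u : hA A) : Prop :=
  ∀ i, u * ff A i (b + 1) =
    qh ^ ip A μ (Finsupp.single i (sg b)) • (ff A i (b + 1) * u)

variable {A}

lemma qComm_one (b : ℤ) : QComm A b 0 1 := fun i => by simp

lemma QComm.mul {b : ℤ} {μ ν : I →₀ ℤ} {u v : hA A} (hu : QComm A b μ u) (hv : QComm A b ν v) :
    QComm A b (μ + ν) (u * v) := fun i => by
  rw [mul_assoc, hv, mul_smul_comm, ← mul_assoc, hu, smul_mul_assoc, smul_smul, ip_add_left,
    zpow_add₀ qh_ne_zero, mul_comm (qh ^ ip A μ _), mul_assoc]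

lemma qComm_ff (j : I) {k b : ℤ} (h : k < b) :
    QComm A b (Finsupp.single j (sg k)) (ff A j k) := fun i => by
  rw [ff_mul_ff A j i (by omega : k < b + 1), if_neg (by omega), add_zero, ip_single_single]
  congr 3
  rw [sg, sg, ← Units.val_mul, ← Int.negOnePow_add, Units.val_inj, Int.negOnePow_eq_iff]
  exact ⟨-k, by ring⟩

lemma qComm_of_mem {k b : ℤ} (h : k < b) {β : I →₀ ℤ} {x : hA A} (hx : x ∈ hAk A k)
    (hβ : x ∈ hAwt A β) : QComm A b β x := by
  obtain ⟨w, hw, rfl⟩ := exists_phi_eq A hx hβ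
  obtain ⟨γ, rfl⟩ : ∃ γ, β = sg k • γ := ⟨sg k • β, by rw [smul_smul, sg_mul_self, one_smul]⟩
  rw [smul_smul, sg_mul_self, one_smul] at hw
  clear hx hβ
  intro i
  have hmon : ∀ l : List I, QComm A b (sg k • wtw l) (phi A k (mon 𝕂 l)) := by
    intro l
    induction l with
    | nil => simpa using qComm_one b
    | cons j l ih =>
      have := (qComm_ff (A := A) j h).mul ih
      rwa [← phi_ι, ← map_mul, ← mon_cons, show Finsupp.single j (sg k) =
        sg k • Finsupp.single j 1 by simp, ← smul_add, ← wtw_cons] at this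
  have := map_mem_of_mon (LinearMap.mulRight 𝕂 (ff A i (b + 1)) ∘ₗ (phi A k).toLinearMap -
    qh ^ ip A (sg k • γ) (Finsupp.single i (sg b)) •
      LinearMap.mulLeft 𝕂 (ff A i (b + 1)) ∘ₗ (phi A k).toLinearMap) ⊥
    (fun l hl => by
      subst hl
      rw [Submodule.mem_bot]
      exact sub_eq_zero.mpr (hmon l i)) hw
  exact sub_eq_zero.mp ((Submodule.mem_bot 𝕂).mp this)

end QuasiCentral

end Boson

namespace Boson

open BraidedFree
open FreeAlgebra (ι)

section Vacuum

/-- `M` is the projection onto the identity component of the decomposition of `Â` into ordered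
products of weight spaces. -/
structure IsVacuum (A : GCM I) (M : hA A →ₗ[𝕂] 𝕂) : Prop where
  one : M 1 = 1
  zero : ∀ (m : ℤ) (β : I →₀ ℤ), β ≠ 0 → ∀ y, y ∈ hAk A m → y ∈ hAwt A β →
    ∀ u ∈ hAgt A m, ∀ v ∈ hAlt A m, M (u * y * v) = 0

variable {A : GCM I} {M : hA A →ₗ[𝕂] 𝕂} (hM : IsVacuum A M)

include hM

lemma IsVacuum.ff_mul (i : I) {b : ℤ} {w : hA A} (hw : w ∈ hAle A b) :
    M (ff A i b * w) = 0 := by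
  replace hw := mem_span_of_mem_hAle A b hw
  induction hw using Submodule.span_induction with
  | mem z hz =>
    obtain ⟨l, v, hv, rfl⟩ := hz
    have hne : sg b • wtw (i :: l) ≠ 0 := by
      intro h
      have h2 := congrArg (sg b • ·) h
      simp only [smul_smul, sg_mul_self, one_smul, smul_zero] at h2
      have h3 := ht_wtw (i :: l)
      rw [h2, List.length_cons] at h3
      simp [ht] at h3
      omega
    have := hM.zero b _ hne _ (phi_mem_hAk A b (mon 𝕂 (i :: l)))
      (phi_mem_hAwt A b (mon_mem_Fw _)) 1 (one_mem _) v hv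
    rwa [one_mul, mon_cons, map_mul (phi A b), phi_ι, mul_assoc] at this
  | zero => simp
  | add z z' _ _ hz hz' => rw [mul_add, map_add, hz, hz', add_zero]
  | smul c z _ hz => rw [mul_smul_comm, map_smul, hz, smul_zero]

lemma IsVacuum.phi_mul {b : ℤ} (x : FreeAlgebra 𝕂 I) {w : hA A} (hw : w ∈ hAle A b) :
    M (phi A b x * w) = eps 𝕂 I x * M w := by
  induction x using word_induction with
  | h1 => simp
  | hadd x y hx hy => rw [map_add, add_mul, map_add, hx, hy, map_add, add_mul]
  | hsmul c x hx =>
    rw [map_smul, smul_mul_assoc, map_smul, hx, map_smul, smul_eq_mul, smul_eq_mul, mul_assoc]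
  | hmul i x hx =>
    rw [map_mul (phi A b), phi_ι, mul_assoc, hM.ff_mul, map_mul, eps_ι, zero_mul, zero_mul]
    exact mul_mem (hAk_le_hAle A le_rfl (phi_mem_hAk A b x)) hw

lemma IsVacuum.phi_mul_phi_mon {b : ℤ} {μ : I →₀ ℤ} {u v : hA A} (hu : u ∈ hAle A b)
    (hμ : QComm A b μ u) (hv : v ∈ hAle A b) (l : List I) (x : FreeAlgebra 𝕂 I) :
    M (phi A b x * u * (phi A (b + 1) (mon 𝕂 l) * v)) =
      qh ^ ip A μ (sg b • wtw l) * form (brd A) (zi A) (mon 𝕂 l) x * M (u * v) := by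
  induction l generalizing x with
  | nil =>
    rw [mon_nil, map_one, one_mul, mul_assoc, hM.phi_mul x (mul_mem hu hv), form_one]
    simp
  | cons i l ih =>
    have h1 : phi A b x * u * (phi A (b + 1) (mon 𝕂 (i :: l)) * v) =
        qh ^ ip A μ (Finsupp.single i (sg b)) •
          (ff A i (b + 1) * (phi A b (kap (brd A) i x) * u * (phi A (b + 1) (mon 𝕂 l) * v)) +
            zi A i • (phi A b (pr (brd A) i x) * u * (phi A (b + 1) (mon 𝕂 l) * v))) := by
      rw [mon_cons, map_mul, phi_ι]
      calc _ = phi A b x * (u * ff A i (b + 1)) * (phi A (b + 1) (mon 𝕂 l) * v) := by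
            simp only [mul_assoc]
        _ = qh ^ ip A μ (Finsupp.single i (sg b)) •
            ((phi A b x * ff A i (b + 1)) * u * (phi A (b + 1) (mon 𝕂 l) * v)) := by
            rw [hμ i, mul_smul_comm, smul_mul_assoc]
            simp only [mul_assoc]
        _ = _ := by
            rw [phi_mul_ff, add_mul, add_mul, smul_mul_assoc, smul_mul_assoc]
            simp only [mul_assoc]
    have hle := hAle_mono A (by omega : b ≤ b + 1)
    rw [h1, map_smul, map_add, hM.ff_mul, zero_add, map_smul, ih, mon_cons, form_ι_mul, wtw_cons,
      smul_add, ip_add_right, zpow_add₀ qh_ne_zero, smul_eq_mul, smul_eq_mul]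
    · simp only [Finsupp.smul_single, smul_eq_mul, mul_one]
      ring
    · exact mul_mem (mul_mem (hAk_le_hAle A (by omega) (phi_mem_hAk A b _)) (hle hu))
        (mul_mem (hAk_le_hAle A le_rfl (phi_mem_hAk A _ _)) (hle hv))

lemma IsVacuum.phi_mul_phi {b : ℤ} {μ γ : I →₀ ℤ} {u v : hA A} (hu : u ∈ hAle A b)
    (hμ : QComm A b μ u) (hv : v ∈ hAle A b) (x : FreeAlgebra 𝕂 I) {y : FreeAlgebra 𝕂 I}
    (hy : y ∈ Fw 𝕂 γ) :
    M (phi A b x * u * (phi A (b + 1) y * v)) =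
      qh ^ ip A μ (sg b • γ) * form (brd A) (zi A) y x * M (u * v) := by
  have := map_mem_of_mon (M ∘ₗ LinearMap.mulLeft 𝕂 (phi A b x * u) ∘ₗ
    LinearMap.mulRight 𝕂 v ∘ₗ (phi A (b + 1)).toLinearMap -
      (qh ^ ip A μ (sg b • γ) * M (u * v)) • (form (brd A) (zi A)).flip x) ⊥
    (fun l hl => by
      subst hl
      rw [Submodule.mem_bot]
      refine sub_eq_zero.mpr ((hM.phi_mul_phi_mon hu hμ hv l x).trans ?_)
      rw [LinearMap.smul_apply, LinearMap.flip_apply, smul_eq_mul]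
      ring) hy
  refine (sub_eq_zero.mp ((Submodule.mem_bot 𝕂).mp this)).trans ?_
  rw [LinearMap.smul_apply, LinearMap.flip_apply, smul_eq_mul]
  ring

variable {Dm : hA A ≃ₐ[𝕂] hA A} (hD : ∀ i p, Dm (ff A i p) = ff A i (p + 1))

omit hM in
include hD in
lemma shift_phi (p : ℤ) (x : FreeAlgebra 𝕂 I) : Dm (phi A p x) = phi A (p + 1) x := by
  have : Dm.toAlgHom.comp (phi A p) = phi A (p + 1) := by
    ext i
    simp [hD]
  exact DFunLike.congr_fun this x

omit hM in
include hD in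
lemma shift_mem_hAle {b : ℤ} {x : hA A} (hx : x ∈ hAle A (b - 1)) : Dm x ∈ hAle A b := by
  have : hAle A (b - 1) ≤ (hAle A b).comap Dm.toAlgHom := by
    refine Algebra.adjoin_le ?_
    rintro _ ⟨i, k, hk, rfl⟩
    exact Algebra.subset_adjoin ⟨i, k + 1, by omega, hD i k⟩
  exact this hx

include hD

lemma IsVacuum.phi_shift_phi (b : ℤ) {γ : I →₀ ℤ} (x : FreeAlgebra 𝕂 I) {y : FreeAlgebra 𝕂 I}
    (hy : y ∈ Fw 𝕂 γ) :
    M (phi A b x * Dm (phi A b y)) = form (brd A) (zi A) y x := by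
  have := hM.phi_mul_phi (one_mem _) (qComm_one b) (one_mem _) x hy
  rw [shift_phi hD]
  simpa [hM.one] using this

/-- The form of two products `x u` and `y v` with leading factors of level `b`. -/
lemma IsVacuum.phi_mul_shift {b : ℤ} {μ γ : I →₀ ℤ} {u v : hA A} (hu : u ∈ hAle A (b - 1))
    (hμ : QComm A b μ u) (hv : v ∈ hAle A (b - 1)) (x : FreeAlgebra 𝕂 I) {y : FreeAlgebra 𝕂 I}
    (hy : y ∈ Fw 𝕂 γ) :
    M (phi A b x * u * Dm (phi A b y * v)) =
      qh ^ ip A μ (sg b • γ) * form (brd A) (zi A) y x * M (u * Dm v) := by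
  rw [map_mul Dm, shift_phi hD, hM.phi_mul_phi (hAle_mono A (by omega) hu) hμ
    (shift_mem_hAle hD hv) x hy]

lemma IsVacuum.pairing_symm_hAk {m : ℤ} {β γ : I →₀ ℤ} {x y : hA A} (hx : x ∈ hAk A m)
    (hx' : x ∈ hAwt A β) (hy : y ∈ hAk A m) (hy' : y ∈ hAwt A γ) :
    M (x * Dm y) = M (y * Dm x) := by
  obtain ⟨w, hw, rfl⟩ := exists_phi_eq A hx hx'
  obtain ⟨z, hz, rfl⟩ := exists_phi_eq A hy hy'
  rw [hM.phi_shift_phi hD m _ hz, hM.phi_shift_phi hD m _ hw, form_symm]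

lemma IsVacuum.eq_of_pairing_ne_zero {m : ℤ} {β γ : I →₀ ℤ} {x y : hA A} (hx : x ∈ hAk A m)
    (hx' : x ∈ hAwt A β) (hy : y ∈ hAk A m) (hy' : y ∈ hAwt A γ) (h : M (x * Dm y) ≠ 0) :
    β = γ := by
  obtain ⟨w, hw, rfl⟩ := exists_phi_eq A hx hx'
  obtain ⟨z, hz, rfl⟩ := exists_phi_eq A hy hy'
  rw [hM.phi_shift_phi hD m _ hz] at h
  by_contra hne
  refine h (form_eq_zero_of_ne _ _ (fun h' => hne ?_) hw hz)
  have := congrArg (sg m • ·) h'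
  simpa only [smul_smul, sg_mul_self, one_smul] using this

end Vacuum

section OrderedProducts

/-- The factors `xs k`, of level `b - k` and weight `βs k`, of an ordered product. -/
def IsFactors (A : GCM I) (b : ℤ) {n : ℕ} (xs : Fin n → hA A) (βs : Fin n → I →₀ ℤ) : Prop :=
  ∀ k : Fin n, xs k ∈ hAk A (b - (k : ℕ)) ∧ xs k ∈ hAwt A (βs k)

variable {A : GCM I}

lemma IsFactors.tail {b : ℤ} {n : ℕ} {xs : Fin (n + 1) → hA A} {βs : Fin (n + 1) → I →₀ ℤ}
    (h : IsFactors A b xs βs) :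
    IsFactors A (b - 1) (fun k => xs k.succ) (fun k => βs k.succ) := fun k => by
  have := h k.succ
  rwa [Fin.val_succ, Nat.cast_succ, ← sub_sub, sub_right_comm] at this

lemma IsFactors.cons {b : ℤ} {n : ℕ} {xs : Fin n → hA A} {βs : Fin n → I →₀ ℤ} {x : hA A}
    {β : I →₀ ℤ} (h : IsFactors A (b - 1) xs βs) (hx : x ∈ hAk A b) (hx' : x ∈ hAwt A β) :
    IsFactors A b (Fin.cons x xs : Fin (n + 1) → hA A) (Fin.cons β βs) := fun k => by
  cases k using Fin.cases with
  | zero => simpa using ⟨hx, hx'⟩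
  | succ k =>
    have := h k
    rw [Fin.val_succ, Nat.cast_succ, ← sub_sub, sub_right_comm, Fin.cons_succ, Fin.cons_succ]
    exact this

lemma IsFactors.prod_mem_hAle {b : ℤ} {n : ℕ} {xs : Fin n → hA A} {βs : Fin n → I →₀ ℤ}
    (h : IsFactors A b xs βs) : (List.ofFn xs).prod ∈ hAle A b := by
  refine list_prod_mem fun x hx => ?_
  obtain ⟨k, rfl⟩ := (List.mem_ofFn' xs x).mp hx
  exact hAk_le_hAle A (by omega) (h k).1

lemma IsFactors.qComm {b c : ℤ} (hbc : b < c) {n : ℕ} {xs : Fin n → hA A}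
    {βs : Fin n → I →₀ ℤ} (h : IsFactors A b xs βs) :
    QComm A c (∑ k, βs k) (List.ofFn xs).prod := by
  induction n generalizing b with
  | zero => simpa using qComm_one c
  | succ n ih =>
    rw [List.ofFn_succ, List.prod_cons, Fin.sum_univ_succ]
    exact (qComm_of_mem (by simpa using hbc) (h 0).1 (h 0).2).mul (ih (by omega) h.tail)

variable {M : hA A →ₗ[𝕂] 𝕂} (hM : IsVacuum A M) {Dm : hA A ≃ₐ[𝕂] hA A}
  (hD : ∀ i p, Dm (ff A i p) = ff A i (p + 1))

include hM hD

theorem IsVacuum.pairing_prod {n : ℕ} {b : ℤ} {xs ys : Fin n → hA A} {βs γs : Fin n → I →₀ ℤ}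
    (hx : IsFactors A b xs βs) (hy : IsFactors A b ys γs) :
    M ((List.ofFn xs).prod * Dm (List.ofFn ys).prod) =
      qh ^ (∑ s, ∑ t, if s < t then ip A (βs s) (βs t) else 0) *
        ∏ k, M (xs k * Dm (ys k)) := by
  induction n generalizing b with
  | zero => simp [hM.one]
  | succ n ih =>
    rw [List.ofFn_succ, List.ofFn_succ, List.prod_cons, List.prod_cons, Fin.prod_univ_succ]
    have hx0 := hx 0
    have hy0 := hy 0
    rw [Fin.val_zero, Nat.cast_zero, sub_zero] at hx0 hy0
    obtain ⟨w, hw, hwx⟩ := exists_phi_eq A hx0.1 hx0.2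
    obtain ⟨z, hz, hzy⟩ := exists_phi_eq A hy0.1 hy0.2
    have key := hM.phi_mul_shift hD hx.tail.prod_mem_hAle (hx.tail.qComm (sub_one_lt b))
      hy.tail.prod_mem_hAle w hz
    rw [← hM.phi_shift_phi hD b w hz, hwx, hzy, ih hx.tail hy.tail, smul_smul, sg_mul_self,
      one_smul] at key
    rw [key]
    by_cases h0 : M (xs 0 * Dm (ys 0)) = 0
    · simp [h0]
    · rw [← hM.eq_of_pairing_ne_zero hD hx0.1 hx0.2 hy0.1 hy0.2 h0, Fin.sum_univ_succ,
        zpow_add₀ qh_ne_zero]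
      have h1 : (∑ t, if (0 : Fin (n + 1)) < t then ip A (βs 0) (βs t) else 0) =
          ip A (∑ k : Fin n, βs k.succ) (βs 0) := by
        rw [Fin.sum_univ_succ, if_neg (lt_irrefl _), zero_add, ip_symm]
        let g : (I →₀ ℤ) →+ ℤ := ⟨⟨ip A (βs 0), ip_zero_right A _⟩, ip_add_right A _⟩
        refine Eq.trans ?_ (map_sum g (fun k : Fin n => βs k.succ) Finset.univ).symm
        exact Finset.sum_congr rfl fun k _ => if_pos k.succ_pos
      rw [h1]
      simp only [Fin.sum_univ_succ (n := n), Fin.succ_lt_succ_iff, Fin.not_lt_zero, if_false,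
        zero_add]
      ring

theorem IsVacuum.pairing_prod_symm {n : ℕ} {b : ℤ} {xs ys : Fin n → hA A}
    {βs γs : Fin n → I →₀ ℤ} (hx : IsFactors A b xs βs) (hy : IsFactors A b ys γs) :
    M ((List.ofFn xs).prod * Dm (List.ofFn ys).prod) =
      M ((List.ofFn ys).prod * Dm (List.ofFn xs).prod) := by
  rw [hM.pairing_prod hD hx hy, hM.pairing_prod hD hy hx]
  have h : ∀ k, M (ys k * Dm (xs k)) = M (xs k * Dm (ys k)) := fun k =>
    hM.pairing_symm_hAk hD (hy k).1 (hy k).2 (hx k).1 (hx k).2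
  simp only [h]
  by_cases h0 : ∏ k, M (xs k * Dm (ys k)) = 0
  · rw [h0, mul_zero, mul_zero]
  · replace h0 := Finset.prod_ne_zero_iff.mp h0
    obtain rfl : βs = γs := funext fun k =>
      hM.eq_of_pairing_ne_zero hD (hx k).1 (hx k).2 (hy k).1 (hy k).2 (h0 k (Finset.mem_univ k))
    rfl

end OrderedProducts

end Boson

namespace Boson

open BraidedFree

section Nondegenerate

variable (A : GCM I)

/-- The ordered products of `n` homogeneous factors of levels `b, b - 1, …`. -/
def orderedProducts (b : ℤ) (n : ℕ) : Set (hA A) :=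
  {x | ∃ (xs : Fin n → hA A) (βs : Fin n → I →₀ ℤ), IsFactors A b xs βs ∧ x = (List.ofFn xs).prod}

variable {A}

lemma one_mem_orderedProducts (b : ℤ) : (1 : hA A) ∈ orderedProducts A b 0 :=
  ⟨Fin.elim0, Fin.elim0, fun k => k.elim0, by simp⟩

lemma phi_mul_mem_orderedProducts {b : ℤ} {n : ℕ} {γ : I →₀ ℤ} {y : FreeAlgebra 𝕂 I}
    (hy : y ∈ Fw 𝕂 γ) {v : hA A} (hv : v ∈ orderedProducts A (b - 1) n) :
    phi A b y * v ∈ orderedProducts A b (n + 1) := by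
  obtain ⟨xs, βs, h, rfl⟩ := hv
  exact ⟨_, _, h.cons (phi_mem_hAk A b y) (phi_mem_hAwt A b hy), by simp [List.ofFn_succ]⟩

lemma exists_qComm_of_mem_orderedProducts {b : ℤ} {n : ℕ} {v : hA A}
    (hv : v ∈ orderedProducts A (b - 1) n) : v ∈ hAle A (b - 1) ∧ ∃ μ, QComm A b μ v := by
  obtain ⟨xs, βs, h, rfl⟩ := hv
  exact ⟨h.prod_mem_hAle, _, h.qComm (sub_one_lt b)⟩

lemma phi_mul_mem_span_orderedProducts {b : ℤ} {n : ℕ} (l : List I) {v : hA A}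
    (hv : v ∈ Submodule.span 𝕂 (orderedProducts A (b - 1) n)) :
    phi A b (mon 𝕂 l) * v ∈ Submodule.span 𝕂 (orderedProducts A b (n + 1)) := by
  induction hv using Submodule.span_induction with
  | mem v hv => exact Submodule.subset_span (phi_mul_mem_orderedProducts (mon_mem_Fw l) hv)
  | zero => simp
  | add x y _ _ hx hy => rw [mul_add]; exact add_mem hx hy
  | smul c x _ hx => rw [mul_smul_comm]; exact Submodule.smul_mem _ _ hx

lemma mem_span_orderedProducts (b : ℤ) (n : ℕ) {x : hA A} (hx : x ∈ hAband A (b + 1 - n) b) :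
    x ∈ Submodule.span 𝕂 (orderedProducts A b n) := by
  induction n generalizing b x with
  | zero =>
    have hempty : {x | ∃ i k, b + 1 - ((0 : ℕ) : ℤ) ≤ k ∧ k ≤ b ∧ x = ff A i k} = ∅ := by
      ext x
      simp only [Set.mem_ofPred_eq, Set.mem_empty_iff_false, iff_false]
      rintro ⟨i, k, h1, h2, _⟩
      push_cast at h1
      omega
    rw [hAband, hempty, Algebra.adjoin_empty, Algebra.mem_bot] at hx
    obtain ⟨c, rfl⟩ := hx
    rw [Algebra.algebraMap_eq_smul_one]
    exact Submodule.smul_mem _ _ (Submodule.subset_span (one_mem_orderedProducts b))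
  | succ n ih =>
    refine (Submodule.span_le.mpr ?_) (mem_span_of_mem_hAband A _ b hx)
    rintro _ ⟨l, v, hv, rfl⟩
    refine phi_mul_mem_span_orderedProducts l (ih (b - 1) ?_)
    rwa [sub_add_cancel, show b - (n : ℤ) = b + 1 - ((n + 1 : ℕ) : ℤ) by push_cast; ring]

lemma exists_mem_span_orderedProducts (x y : hA A) : ∃ (b : ℤ) (n : ℕ),
    x ∈ Submodule.span 𝕂 (orderedProducts A b n) ∧
      y ∈ Submodule.span 𝕂 (orderedProducts A b n) := by
  obtain ⟨N, hN⟩ := exists_mem_hAband A x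
  obtain ⟨N', hN'⟩ := exists_mem_hAband A y
  refine ⟨max N N', 2 * max N N' + 1, mem_span_orderedProducts _ _ (hAband_mono A ?_ ?_ hN),
    mem_span_orderedProducts _ _ (hAband_mono A ?_ ?_ hN')⟩ <;> push_cast <;> omega

/-- A spanning set `B` for the levels less than `b` spans the levels at most `b` with coefficients
in `Â[b]`. -/
lemma exists_sum_phi_mul {b : ℤ} {n : ℕ} {B : Set (hA A)}
    (hB : orderedProducts A (b - 1) n ⊆ Submodule.span 𝕂 B) {x : hA A}
    (hx : x ∈ Submodule.span 𝕂 (orderedProducts A b (n + 1))) :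
    ∃ w : B →₀ FreeAlgebra 𝕂 I, x = w.sum fun v a => phi A b a * v := by
  let F : (B →₀ FreeAlgebra 𝕂 I) →ₗ[𝕂] hA A := Finsupp.lsum 𝕂 fun v : B =>
    LinearMap.mulRight 𝕂 (v : hA A) ∘ₗ (phi A b).toLinearMap
  suffices h : Submodule.span 𝕂 (orderedProducts A b (n + 1)) ≤ LinearMap.range F by
    obtain ⟨w, hw⟩ := h hx
    exact ⟨w, hw.symm⟩
  refine Submodule.span_le.mpr ?_
  rintro _ ⟨xs, βs, h, rfl⟩
  have h0 := h 0
  rw [Fin.val_zero, Nat.cast_zero, sub_zero] at h0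
  obtain ⟨w, hw, hwx⟩ := exists_phi_eq A h0.1 h0.2
  rw [List.ofFn_succ, List.prod_cons, ← hwx]
  have hv := hB ⟨_, _, h.tail, rfl⟩
  have hmul : Submodule.span 𝕂 B ≤ (LinearMap.range F).comap (LinearMap.mulLeft 𝕂 (phi A b w)) := by
    refine Submodule.span_le.mpr fun v hv => ⟨Finsupp.single ⟨v, hv⟩ w, ?_⟩
    simp [F]
  exact hmul hv

variable {M : hA A →ₗ[𝕂] 𝕂} (hM : IsVacuum A M) {Dm : hA A ≃ₐ[𝕂] hA A}
  (hD : ∀ i p, Dm (ff A i p) = ff A i (p + 1))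

include hM hD

theorem IsVacuum.pairing_symm (x y : hA A) : M (x * Dm y) = M (y * Dm x) := by
  obtain ⟨b, n, hx, hy⟩ := exists_mem_span_orderedProducts x y
  induction hx using Submodule.span_induction with
  | mem x hx =>
    induction hy using Submodule.span_induction with
    | mem y hy =>
      obtain ⟨xs, βs, hxs, rfl⟩ := hx
      obtain ⟨ys, γs, hys, rfl⟩ := hy
      exact hM.pairing_prod_symm hD hxs hys
    | zero => simp
    | add y z _ _ hy hz => simp only [map_add, mul_add, add_mul, hy, hz]
    | smul c y _ hy => simp only [map_smul, mul_smul_comm, smul_mul_assoc, hy]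
  | zero => simp
  | add y z _ _ hy hz => simp only [map_add, mul_add, add_mul, hy, hz]
  | smul c y _ hy => simp only [map_smul, mul_smul_comm, smul_mul_assoc, hy]

lemma IsVacuum.eq_zero_of_pairing_orderedProducts (b : ℤ) (n : ℕ) {x : hA A}
    (hx : x ∈ Submodule.span 𝕂 (orderedProducts A b n))
    (h : ∀ y ∈ orderedProducts A b n, M (x * Dm y) = 0) : x = 0 := by
  induction n generalizing b x with
  | zero =>
    have hle : Submodule.span 𝕂 (orderedProducts A b 0) ≤ Submodule.span 𝕂 {1} := by
      refine Submodule.span_mono ?_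
      rintro _ ⟨xs, _, _, rfl⟩
      simp
    obtain ⟨c, rfl⟩ := Submodule.mem_span_singleton.mp (hle hx)
    have := h 1 (one_mem_orderedProducts b)
    rw [map_one, mul_one, map_smul, hM.one, smul_eq_mul, mul_one] at this
    rw [this, zero_smul]
  | succ n ih =>
    obtain ⟨B, hBs, hBspan, hBind⟩ :=
      exists_linearIndependent 𝕂 (orderedProducts A (b - 1) n)
    obtain ⟨w, rfl⟩ := exists_sum_phi_mul
      (hBspan ▸ Submodule.subset_span : orderedProducts A (b - 1) n ⊆ Submodule.span 𝕂 B) hx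
    choose hle μ hμ using fun v : B => exists_qComm_of_mem_orderedProducts (hBs v.2)
    refine Finset.sum_eq_zero fun v hv => ?_
    change phi A b (w v) * (v : hA A) = 0
    suffices hrad : w v ∈ rad (brd A) (zi A) by
      rw [phi_eq_zero_of_mem_rad A b hrad, zero_mul]
    rw [mem_rad]
    intro y
    induction y using mon_induction with
    | h0 => simp
    | hadd x y hx hy => rw [map_add, LinearMap.add_apply, hx, hy, add_zero]
    | hsmul c x hx => rw [map_smul, LinearMap.smul_apply, hx, smul_zero]
    | hw l =>
      let e : B → 𝕂 := fun v =>
        qh ^ ip A (μ v) (sg b • wtw l) * form (brd A) (zi A) (mon 𝕂 l) (w v)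
      have hsum : ∑ v ∈ w.support, e v • (v : hA A) = 0 := by
        refine ih (b - 1) (sum_mem fun v _ => Submodule.smul_mem _ _ <|
          Submodule.subset_span (hBs v.2)) fun z hz => ?_
        have := h _ (phi_mul_mem_orderedProducts (mon_mem_Fw l) hz)
        rw [Finsupp.sum, Finset.sum_mul, map_sum] at this
        rw [Finset.sum_mul, map_sum, ← this]
        refine Finset.sum_congr rfl fun v _ => ?_
        rw [hM.phi_mul_shift hD (hle v) (hμ v) (exists_qComm_of_mem_orderedProducts hz).1 (w v)
          (mon_mem_Fw l), smul_mul_assoc, map_smul, smul_eq_mul]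
      have he := linearIndependent_iff'.mp hBind w.support e hsum v hv
      exact (mul_eq_zero.mp he).resolve_left (zpow_ne_zero _ qh_ne_zero)

theorem IsVacuum.eq_zero_of_pairing (x : hA A) (h : ∀ y, M (x * Dm y) = 0) : x = 0 := by
  obtain ⟨b, n, hx, -⟩ := exists_mem_span_orderedProducts x x
  exact hM.eq_zero_of_pairing_orderedProducts hD b n hx fun y _ => h y

end Nondegenerate

end Boson

/-- the bilinear form `⟨⟨x,y⟩⟩ = M(x 𝒟̄(y))` on `Â` is symmetric and
non-degenerate; moreover for ordered products `x = x_b x_{b-1} ⋯ x_a` and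
`y = y_b y_{b-1} ⋯ y_a` with homogeneous `x_k, y_k ∈ Â[k]` (the `k`-th factor below,
`k : Fin (b+1-a)`, lies in `Â[b-k]`),
`⟨⟨x,y⟩⟩ = q^{Σ_{s<t} (wt x_s, wt x_t)} Π_k ⟨⟨x_k, y_k⟩⟩`. -/
theorem statement15 (A : GCM I)
    (M : hA A →ₗ[𝕂] 𝕂)
    (hMone : M 1 = 1)
    (hMzero : ∀ (m : ℤ) (β : I →₀ ℤ), β ≠ 0 → ∀ y, y ∈ hAk A m → y ∈ hAwt A β →
      ∀ u ∈ hAgt A m, ∀ v ∈ hAlt A m, M (u * y * v) = 0)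
    (Dm : hA A ≃ₐ[𝕂] hA A)
    (hD : ∀ i p, Dm (ff A i p) = ff A i (p + 1)) :
    (∀ x y : hA A, M (x * Dm y) = M (y * Dm x)) ∧
    (∀ x : hA A, (∀ y : hA A, M (x * Dm y) = 0) → x = 0) ∧
    (∀ (a b : ℤ) (xs ys : Fin (b + 1 - a).toNat → hA A)
        (βs γs : Fin (b + 1 - a).toNat → (I →₀ ℤ)),
      (∀ k : Fin (b + 1 - a).toNat, xs k ∈ hAk A (b - (k : ℕ)) ∧ xs k ∈ hAwt A (βs k)) →
      (∀ k : Fin (b + 1 - a).toNat, ys k ∈ hAk A (b - (k : ℕ)) ∧ ys k ∈ hAwt A (γs k)) →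
      M ((List.ofFn xs).prod * Dm (List.ofFn ys).prod) =
        qh ^ (∑ s : Fin (b + 1 - a).toNat, ∑ t : Fin (b + 1 - a).toNat,
            if s < t then ip A (βs s) (βs t) else 0) *
          ∏ k : Fin (b + 1 - a).toNat, M (xs k * Dm (ys k))) := by
  have hM : Boson.IsVacuum A M := ⟨hMone, hMzero⟩
  exact ⟨hM.pairing_symm hD, hM.eq_zero_of_pairing hD,
    fun a b xs ys βs γs hx hy => hM.pairing_prod hD hx hy⟩

end
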